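/- arXiv:1103.1979 — 2 statements merged into one kernel-verified Lean document; each statement's English description precedes it below -/
import Mathlib

section
/- Let F_1(u,v) = 20736u^{10} + v^{10} and F_2(u,v) = 429981696u^{20} + 1558683648u^{15}v^5 - 207484416u^{10}v^{10} - 75168u^5v^{15} + v^{20}. If u, v are coprime integers and y is an integer with y^2 = F_1(u,v) \cdot F_2(u,v), then uv = 0; more precisely (u, v, y) is one of (0, 1, \pm 1), (0, -1, \pm 1), (1, 0, \pm 2985984), (-1, 0, \pm 2985984). -/
namespace C2
/-- The ring of integers `ℤ[φ]` of `ℚ(√5)`. -/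
abbrev Zphi := QuadraticAlgebra ℤ 1 1

theorem norm_eq (z : Zphi) : QuadraticAlgebra.norm z = z.re ^ 2 + z.re * z.im - z.im ^ 2 := by
  rw [QuadraticAlgebra.norm_def]; ring

theorem sq_eq_five_sq (a b : ℤ) (h : a ^ 2 = 5 * b ^ 2) : b = 0 := by
  by_contra hb
  have h1 : ¬ IsSquare (5 : ℤ) := by
    rintro ⟨r, hr⟩
    have : r < 3 := by nlinarith
    have : -3 < r := by nlinarith
    interval_cases r <;> omega
  have h2 : b ^ 2 ∣ a ^ 2 := ⟨5, by linarith⟩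
  rw [Int.pow_dvd_pow_iff two_ne_zero] at h2
  obtain ⟨c, rfl⟩ := h2
  apply h1
  refine ⟨c, ?_⟩
  have : b ^ 2 * (5 - c * c) = 0 := by linear_combination -h
  rcases mul_eq_zero.1 this with h3 | h3
  · exact absurd (pow_eq_zero_iff two_ne_zero |>.1 h3) hb
  · linarith

theorem norm_eq_zero (z : Zphi) (h : QuadraticAlgebra.norm z = 0) : z = 0 := by
  rw [norm_eq] at h
  have h2 := sq_eq_five_sq (2 * z.re + z.im) z.im (by linear_combination 4 * h)
  have h1 : z.re = 0 := by
    rw [h2] at h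
    simpa using h
  ext <;> simp [h1, h2]

theorem exists_round (s n : ℤ) (hn : n ≠ 0) : ∃ q : ℤ, 2 * |s - n * q| ≤ |n| := by
  have h1 := Int.emod_nonneg s hn
  have h2 := Int.emod_lt_abs s hn
  have h3 := Int.emod_add_mul_ediv s n
  by_cases h : 2 * (s % n) ≤ |n|
  · refine ⟨s / n, ?_⟩
    rw [show s - n * (s / n) = s % n by linarith, abs_of_nonneg h1]
    exact h
  · rcases abs_cases n with ⟨h4, h5⟩ | ⟨h4, h5⟩
    · refine ⟨s / n + 1, ?_⟩
      rw [show s - n * (s / n + 1) = s % n - n by linarith, abs_of_nonpos (by linarith)]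
      linarith
    · refine ⟨s / n - 1, ?_⟩
      rw [show s - n * (s / n - 1) = s % n + n by linarith, abs_of_nonpos (by linarith)]
      linarith

theorem exists_div (x y : Zphi) (hy : y ≠ 0) :
    ∃ q : Zphi, (QuadraticAlgebra.norm (x - y * q)).natAbs < (QuadraticAlgebra.norm y).natAbs := by
  have hn : QuadraticAlgebra.norm y ≠ 0 := fun h => hy (norm_eq_zero y h)
  obtain ⟨q1, h1⟩ := exists_round (x * star y).re _ hn
  obtain ⟨q2, h2⟩ := exists_round (x * star y).im _ hn
  refine ⟨⟨q1, q2⟩, ?_⟩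
  set n := QuadraticAlgebra.norm y with hnd
  set e1 := (x * star y).re - n * q1 with he1
  set e2 := (x * star y).im - n * q2 with he2
  have key : QuadraticAlgebra.norm (x - y * ⟨q1, q2⟩) * n = e1 ^ 2 + e1 * e2 - e2 ^ 2 := by
    rw [he1, he2, hnd, norm_eq, norm_eq]
    simp
    ring
  have hb : |e1 ^ 2 + e1 * e2 - e2 ^ 2| < |n| * |n| := by
    have hp : 0 < |n| := abs_pos.2 hn
    have ha1 := abs_le.1 (le_refl |e1|)
    have ha2 := abs_le.1 (le_refl |e2|)
    have k1 : 4 * e1 ^ 2 ≤ |n| * |n| := by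
      rw [← sq_abs e1]; nlinarith [abs_nonneg e1]
    have k2 : 4 * e2 ^ 2 ≤ |n| * |n| := by
      rw [← sq_abs e2]; nlinarith [abs_nonneg e2]
    rw [abs_lt]
    constructor <;> nlinarith [sq_nonneg (e1 + e2), sq_nonneg (e1 - e2)]
  rw [← key, abs_mul] at hb
  have := lt_of_mul_lt_mul_right hb (abs_nonneg n)
  rw [Int.abs_eq_natAbs, Int.abs_eq_natAbs] at this
  exact_mod_cast this

open Classical in
/-- `ℤ[φ]` is Euclidean. -/
noncomputable def zphiEuclidean : EuclideanDomain Zphi :=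
  { (inferInstance : CommRing Zphi), (inferInstance : Nontrivial Zphi) with
    quotient := fun x y => if h : y = 0 then 0 else (exists_div x y h).choose
    remainder := fun x y => x - y * (if h : y = 0 then 0 else (exists_div x y h).choose)
    quotient_zero := by intro a; simp
    quotient_mul_add_remainder_eq := fun x y => by ring
    r := fun a b => (QuadraticAlgebra.norm a).natAbs < (QuadraticAlgebra.norm b).natAbs
    r_wellFounded := (measure (fun a : Zphi => (QuadraticAlgebra.norm a).natAbs)).wf
    remainder_lt := fun a b b0 => by
      simp only [b0, dite_false]
      exact (exists_div a b b0).choose_spec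
    mul_left_not_lt := fun a b b0 => by
      rw [not_lt, map_mul, Int.natAbs_mul]
      apply Nat.le_mul_of_pos_right
      rw [Int.natAbs_pos]
      exact fun h => b0 (norm_eq_zero b h) }

instance zphi_isDomain : IsDomain Zphi := @EuclideanDomain.instIsDomain _ zphiEuclidean

instance zphi_pid : IsPrincipalIdealRing Zphi :=
  @EuclideanDomain.to_principal_ideal_domain _ zphiEuclidean

theorem zphi_pow (a b c : Zphi) (hab : IsCoprime a b) (k : ℕ) (h : a * b = c ^ k) :
    ∃ d, Associated (d ^ k) a :=
  exists_associated_pow_of_mul_eq_pow' hab h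


theorem pell_fund : Pell.IsFundamental (Pell.Solution₁.mk 9 4 (by norm_num) : Pell.Solution₁ 5) := by
  refine ⟨by simp, by simp, ?_⟩
  intro a ha
  rw [Pell.Solution₁.x_mk]
  by_contra! hlt
  have hp := a.prop
  set X := a.x
  set Y := a.y
  have hY1 : Y < 5 := by nlinarith
  have hY2 : -5 < Y := by nlinarith
  interval_cases X <;> interval_cases Y <;> omega

theorem y_pow_five {d : ℤ} (a : Pell.Solution₁ d) :
    (a ^ 5).x = a.x * (a.x ^ 4 + 10 * d * a.x ^ 2 * a.y ^ 2 + 5 * d ^ 2 * a.y ^ 4) ∧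
    (a ^ 5).y = a.y * (5 * a.x ^ 4 + 10 * d * a.x ^ 2 * a.y ^ 2 + d ^ 2 * a.y ^ 4) := by
  rw [show a ^ 5 = a * a * a * a * a by simp only [pow_succ, pow_zero, one_mul]]
  simp only [Pell.Solution₁.x_mul, Pell.Solution₁.y_mul]
  constructor <;> ring

theorem unit_one (e f : ℤ) (h : e ^ 2 - 5 * f ^ 2 = 1) (h5 : (5 : ℤ) ∣ f) :
    ∃ a b : ℤ, e = a * (a ^ 4 + 50 * a ^ 2 * b ^ 2 + 125 * b ^ 4) ∧
      f = 5 * b * (a ^ 4 + 10 * a ^ 2 * b ^ 2 + 5 * b ^ 4) := by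
  set F : Pell.Solution₁ 5 := Pell.Solution₁.mk 9 4 (by norm_num) with hF
  have hx1 : F.x = 9 := by simp [hF]
  have hy1 : F.y = 4 := by simp [hF]
  obtain ⟨k, hk⟩ := pell_fund.eq_zpow_or_neg_zpow (Pell.Solution₁.mk e f h)
  rw [← hF] at hk
  have hdvd : (5 : ℤ) ∣ (F ^ k).y := by
    rcases hk with hk | hk
    · rw [← hk]; simpa using h5
    · have : F ^ k = - (Pell.Solution₁.mk e f h) := by rw [hk, neg_neg]
      rw [this]; simpa using h5
  have hkq : F ^ k = (F ^ (k / 5)) ^ 5 * F ^ (k % 5).toNat := by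
    rw [← zpow_natCast (F ^ (k / 5)) 5, ← zpow_mul, ← zpow_natCast F, ← zpow_add]
    congr 1
    omega
  set G := F ^ (k / 5) with hG
  obtain ⟨gx, gy⟩ := y_pow_five G
  have hGp := G.prop
  have hk5 : (k % 5).toNat = 0 := by
    by_contra hne
    have hlt : (k % 5).toNat < 5 := by omega
    rw [hkq, Pell.Solution₁.y_mul] at hdvd
    have hdy : (5 : ℤ) ∣ (G ^ 5).y := by
      rw [gy]
      exact ⟨G.y * (G.x ^ 4 + 10 * G.x ^ 2 * G.y ^ 2 + 5 * G.y ^ 4), by ring⟩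
    have h1 : (5 : ℤ) ∣ (G ^ 5).x * (F ^ (k % 5).toNat).y := by
      exact (Int.dvd_add_left (Dvd.dvd.mul_right hdy _)).1 hdvd
    have p5 : Prime (5 : ℤ) := by norm_num
    rcases p5.dvd_or_dvd h1 with h2 | h2
    · have hq := (G ^ 5).prop
      have : (5 : ℤ) ∣ 1 := by
        rw [← hq]
        exact dvd_sub (dvd_pow h2 two_ne_zero) (Dvd.intro _ rfl)
      omega
    · generalize (k % 5).toNat = j at *
      interval_cases j
      · exact hne rfl
      · simp [hy1] at h2
      · rw [pow_succ, pow_one, Pell.Solution₁.y_mul, hx1, hy1] at h2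
        omega
      · simp only [pow_succ, pow_zero, one_mul, Pell.Solution₁.y_mul, Pell.Solution₁.x_mul, hx1, hy1] at h2
        omega
      · simp only [pow_succ, pow_zero, one_mul, Pell.Solution₁.y_mul, Pell.Solution₁.x_mul, hx1, hy1] at h2
        omega
  rw [hk5, pow_zero, mul_one] at hkq
  rw [hkq] at hk
  rcases hk with hk | hk
  · refine ⟨G.x, G.y, ?_, ?_⟩
    · have := congrArg Pell.Solution₁.x hk
      rw [gx, Pell.Solution₁.x_mk] at this
      rw [this]; ring
    · have := congrArg Pell.Solution₁.y hk
      rw [gy, Pell.Solution₁.y_mk] at this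
      rw [this]; ring
  · refine ⟨-G.x, -G.y, ?_, ?_⟩
    · have := congrArg Pell.Solution₁.x hk
      rw [Pell.Solution₁.x_neg, gx, Pell.Solution₁.x_mk] at this
      rw [this]; ring
    · have := congrArg Pell.Solution₁.y hk
      rw [Pell.Solution₁.y_neg, gy, Pell.Solution₁.y_mk] at this
      rw [this]; ring

theorem unit_pm (e f : ℤ) (h : e ^ 2 - 5 * f ^ 2 = 1 ∨ e ^ 2 - 5 * f ^ 2 = -1) (h5 : (5 : ℤ) ∣ f) :
    ∃ a b : ℤ, e = a * (a ^ 4 + 50 * a ^ 2 * b ^ 2 + 125 * b ^ 4) ∧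
      f = 5 * b * (a ^ 4 + 10 * a ^ 2 * b ^ 2 + 5 * b ^ 4) := by
  rcases h with h | h
  · exact unit_one e f h h5
  · obtain ⟨a, b, h1, h2⟩ := unit_one (682 * e + 5 * 305 * f) (305 * e + 682 * f)
      (by linear_combination (-1) * h) (by omega)
    refine ⟨-2 * a + 5 * b, a - 2 * b, ?_, ?_⟩
    · have : e = -682 * (682 * e + 5 * 305 * f) + 5 * 305 * (305 * e + 682 * f) := by ring
      rw [this, h1, h2]; ring
    · have : f = 305 * (682 * e + 5 * 305 * f) - 682 * (305 * e + 682 * f) := by ring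
      rw [this, h1, h2]; ring

theorem adjust (d : Zphi) : ∃ t s : Zphi, t * s = 1 ∧ Even (d * t).im := by
  rcases Int.even_or_odd d.im with h | h
  · exact ⟨1, 1, by simp, by simpa using h⟩
  · rcases Int.even_or_odd d.re with h' | h'
    · refine ⟨⟨1, 1⟩, ⟨2, -1⟩, by ext <;> simp [QuadraticAlgebra.re_one, QuadraticAlgebra.im_one], ?_⟩
      simp
      obtain ⟨r, hr⟩ := h'
      exact ⟨r + d.im, by rw [hr]; ring⟩
    · refine ⟨⟨0, 1⟩, ⟨-1, 1⟩, by ext <;> simp [QuadraticAlgebra.re_one, QuadraticAlgebra.im_one], ?_⟩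
      simp
      exact h'.add_odd h

theorem fifth_power (P Q n : ℤ) (hco : IsCoprime P Q) (h10 : (10 : ℤ) ∣ Q)
    (h : P ^ 2 - 5 * Q ^ 2 = n ^ 5) :
    ∃ A B : ℤ, P = A * (A ^ 4 + 50 * A ^ 2 * B ^ 2 + 125 * B ^ 4) ∧
      Q = 5 * B * (A ^ 4 + 10 * A ^ 2 * B ^ 2 + 5 * B ^ 4) := by
  have hP10 : IsCoprime P 10 := hco.of_isCoprime_of_dvd_right h10
  have hP5 : ¬ (5 : ℤ) ∣ P := fun hd => by
    have := hP10.of_isCoprime_of_dvd_left hd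
    have := Int.isCoprime_iff_gcd_eq_one.1 this
    norm_num at this
  have hP2 : ¬ (2 : ℤ) ∣ P := fun hd => by
    have := hP10.of_isCoprime_of_dvd_left hd
    have := Int.isCoprime_iff_gcd_eq_one.1 this
    norm_num at this
  set x : Zphi := ⟨P - Q, 2 * Q⟩ with hx
  have hxs : x * star x = ((n : ℤ) : Zphi) ^ 5 := by
    rw [← Int.cast_pow, ← h]
    ext
    · rw [QuadraticAlgebra.re_intCast]; simp [hx]; ring
    · rw [QuadraticAlgebra.im_intCast]; simp [hx]; ring
  have hcop : IsCoprime x (star x) := by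
    have h1 : IsCoprime (2 * P) (P ^ 2 - 5 * Q ^ 2) := by
      apply IsCoprime.mul_left
      · rw [Int.prime_two.coprime_iff_not_dvd]
        intro h2
        obtain ⟨q, rfl⟩ := h10
        have : (2 : ℤ) ∣ P ^ 2 := by
          have := dvd_add h2 (Dvd.intro (250 * q ^ 2) rfl : (2 : ℤ) ∣ 2 * (250 * q ^ 2))
          rwa [show P ^ 2 - 5 * (10 * q) ^ 2 + 2 * (250 * q ^ 2) = P ^ 2 by ring] at this
        exact hP2 (Int.prime_two.dvd_of_dvd_pow this)
      · have h2 : IsCoprime P (5 * Q ^ 2) := 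
          (hP10.of_isCoprime_of_dvd_right (by norm_num)).mul_right hco.pow_right
        have := h2.neg_right.add_mul_left_right P
        rwa [show -(5 * Q ^ 2) + P * P = P ^ 2 - 5 * Q ^ 2 by ring] at this
    obtain ⟨a, b, hab⟩ := h1
    refine ⟨(a : Zphi) + b * star x, a, ?_⟩
    have h2 : x + star x = ((2 * P : ℤ) : Zphi) := by
      ext
      · rw [QuadraticAlgebra.re_intCast]; simp [hx]; ring
      · rw [QuadraticAlgebra.im_intCast]; simp [hx]
    have h3 : x * star x = ((P ^ 2 - 5 * Q ^ 2 : ℤ) : Zphi) := by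
      rw [hxs, h]; push_cast; rfl
    calc ((a : Zphi) + b * star x) * x + a * star x = a * (x + star x) + b * (x * star x) := by ring
      _ = ((a * (2 * P) + b * (P ^ 2 - 5 * Q ^ 2) : ℤ) : Zphi) := by
        rw [h2, h3]; push_cast; ring
      _ = 1 := by rw [hab]; simp
  obtain ⟨d, w0, hw0⟩ := zphi_pow x (star x) n hcop 5 hxs
  obtain ⟨t, s, hts, B, hB⟩ := adjust d
  have hxw : x = (d * t) ^ 5 * (s ^ 5 * (w0 : Zphi)) := by
    rw [← hw0]
    calc d ^ 5 * (w0 : Zphi) = d ^ 5 * (t * s) ^ 5 * w0 := by rw [hts]; ring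
      _ = _ := by ring
  have hwu : IsUnit (s ^ 5 * (w0 : Zphi)) :=
    ((IsUnit.of_mul_eq_one t (by rw [mul_comm]; exact hts)).pow 5).mul w0.isUnit
  set w := s ^ 5 * (w0 : Zphi) with hw
  have hwn := QuadraticAlgebra.isUnit_iff_norm_isUnit.1 hwu
  rw [norm_eq, Int.isUnit_iff] at hwn
  set A := (d * t).re + B with hA
  have hd : d * t = ⟨A - B, 2 * B⟩ := by ext <;> simp [hA, hB]; ring
  set P' := A * (A ^ 4 + 50 * A ^ 2 * B ^ 2 + 125 * B ^ 4) with hP'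
  set Q' := 5 * B * (A ^ 4 + 10 * A ^ 2 * B ^ 2 + 5 * B ^ 4) with hQ'
  have hd5 : (d * t) ^ 5 = ⟨P' - Q', 2 * Q'⟩ := by
    rw [hd]
    ext <;> simp [pow_succ, hP', hQ'] <;> ring
  rw [hd5] at hxw
  have e1 := congrArg QuadraticAlgebra.re hxw
  have e2 := congrArg QuadraticAlgebra.im hxw
  simp [hx] at e1 e2
  -- the unit has even imaginary part
  have hwe : Even w.im := by
    by_contra hne
    rw [Int.not_even_iff_odd] at hne
    have : Even (P' - Q') := by
      have h1 : Even ((P' - Q') * w.im) :=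
        ⟨Q - Q' * w.re - Q' * w.im, by linear_combination -e2⟩
      rcases Int.even_mul.1 h1 with h1 | h1
      · exact h1
      · exact absurd h1 (Int.not_even_iff_odd.2 hne)
    obtain ⟨c, hc⟩ := this
    obtain ⟨q, rfl⟩ := h10
    exact hP2 ⟨c * w.re + Q' * w.im + 5 * q, by rw [hc] at e1; linear_combination e1⟩
  obtain ⟨f, hf⟩ := hwe
  set e := w.re + f with he
  have hre : w.re = e - f := by rw [he]; ring
  rw [hre, hf] at e1 e2 hwn
  have E2 : Q = e * Q' + f * P' := by linarith
  have E1 : P = e * P' + 5 * f * Q' := by linarith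
  have h5f : (5 : ℤ) ∣ f := by
    have p5 : Prime (5 : ℤ) := by norm_num
    have h1 : (5 : ℤ) ∣ f * P' := by
      obtain ⟨q, hq⟩ := h10
      exact ⟨2 * q - e * B * (A ^ 4 + 10 * A ^ 2 * B ^ 2 + 5 * B ^ 4), by
        rw [hq, hQ'] at E2; linear_combination -E2⟩
    rcases p5.dvd_or_dvd h1 with h2 | h2
    · exact h2
    · exact absurd (by rw [E1]; exact dvd_add (Dvd.dvd.mul_left h2 _) (by rw [mul_assoc]; exact Dvd.intro _ rfl)) hP5
  obtain ⟨a, b, ha, hb⟩ := unit_pm e f (by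
    rcases hwn with h1 | h1
    · left; linear_combination h1
    · right; linear_combination h1) h5f
  refine ⟨a * A + 5 * b * B, a * B + b * A, ?_, ?_⟩
  · rw [E1, ha, hb, hP', hQ']; ring
  · rw [E2, ha, hb, hP', hQ']; ring

/-- The quartic form occurring in the descent. -/
def MM (A B : ℤ) : ℤ := A ^ 4 + 10 * A ^ 2 * B ^ 2 + 5 * B ^ 4

theorem coprime_thirty (n : ℤ) (h2 : ¬ (2 : ℤ) ∣ n) (h3 : ¬ (3 : ℤ) ∣ n) (h5 : ¬ (5 : ℤ) ∣ n) :
    IsCoprime n 30 := by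
  have e : (30 : ℤ) = 2 * 3 * 5 := by norm_num
  have p2 : Prime (2 : ℤ) := by norm_num
  have p3 : Prime (3 : ℤ) := by norm_num
  have p5 : Prime (5 : ℤ) := by norm_num
  rw [e]
  exact (((p2.coprime_iff_not_dvd).2 h2).symm.mul_right ((p3.coprime_iff_not_dvd).2 h3).symm).mul_right
    ((p5.coprime_iff_not_dvd).2 h5).symm

theorem three_form : ∀ a b : ZMod 3, a ^ 4 + a ^ 2 * b ^ 2 + 2 * b ^ 4 = 0 → a = 0 ∧ b = 0 := by
  decide

theorem not_both_dvd {A B : ℤ} (h : IsCoprime A B) (p : ℤ) (hp : Prime p) (ha : p ∣ A) (hb : p ∣ B) :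
    False := hp.not_isUnit (h.isUnit_of_dvd' ha hb)

theorem MM_coprime_thirty (A B : ℤ) (h : IsCoprime A B) (ho : Odd (A + B)) (h5 : ¬ (5 : ℤ) ∣ A) :
    IsCoprime (MM A B) 30 := by
  apply coprime_thirty
  · intro hd
    obtain ⟨t, ht⟩ := ho
    have h1 : (2 : ℤ) ∣ (A ^ 2 + 5 * B ^ 2) ^ 2 := by
      have := dvd_add hd (Dvd.intro (10 * B ^ 4) rfl)
      rwa [show MM A B + 2 * (10 * B ^ 4) = (A ^ 2 + 5 * B ^ 2) ^ 2 by unfold MM; ring] at this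
    have h2 := Int.prime_two.dvd_of_dvd_pow h1
    obtain rfl : A = 2 * t + 1 - B := by linarith
    have h3 : Odd ((2 * t + 1 - B) ^ 2 + 5 * B ^ 2) :=
      ⟨2 * t ^ 2 + 2 * t - 2 * t * B - B + 3 * B ^ 2, by ring⟩
    rw [← even_iff_two_dvd] at h2
    exact absurd h2 (Int.not_even_iff_odd.2 h3)
  · intro hd
    have h1 := (ZMod.intCast_zmod_eq_zero_iff_dvd (MM A B) 3).2 (by exact_mod_cast hd)
    unfold MM at h1
    push_cast at h1
    have h10 : (10 : ZMod 3) = 1 := by decide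
    have h55 : (5 : ZMod 3) = 2 := by decide
    rw [h10, h55, one_mul] at h1
    obtain ⟨ha, hb⟩ := three_form _ _ h1
    rw [ZMod.intCast_zmod_eq_zero_iff_dvd] at ha hb
    exact not_both_dvd h 3 (by norm_num) (by exact_mod_cast ha) (by exact_mod_cast hb)
  · intro hd
    have h1 : (5 : ℤ) ∣ A ^ 4 := by
      have := dvd_sub hd (Dvd.intro (2 * A ^ 2 * B ^ 2 + B ^ 4) rfl)
      rwa [show MM A B - 5 * (2 * A ^ 2 * B ^ 2 + B ^ 4) = A ^ 4 by unfold MM; ring] at this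
    exact h5 ((by norm_num : Prime (5 : ℤ)).dvd_of_dvd_pow h1)

theorem MM_coprime_right (A B : ℤ) (h : IsCoprime A B) : IsCoprime (MM A B) B := by
  have h1 : IsCoprime (A ^ 4) B := h.pow_left
  have := h1.add_mul_left_left (10 * A ^ 2 * B + 5 * B ^ 3)
  rwa [show A ^ 4 + B * (10 * A ^ 2 * B + 5 * B ^ 3) = MM A B by unfold MM; ring] at this

theorem descent_step (P Q n D k : ℤ) (e : ℕ) (hco : IsCoprime P Q) (h10 : (10 : ℤ) ∣ Q)
    (h25 : (25 : ℤ) ∣ Q) (h : P ^ 2 - 5 * Q ^ 2 = n ^ 5) (hD : D ∣ 30 ^ e) (hDQ : D * Q = k ^ 5) :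
    ∃ A B m d k' : ℤ, ∃ e' : ℕ, IsCoprime A B ∧ Odd (A + B) ∧ ¬ (5 : ℤ) ∣ A ∧ (5 : ℤ) ∣ B ∧
      MM A B = m ^ 5 ∧ d ∣ 30 ^ e' ∧ d * B = k' ^ 5 ∧ Q = 5 * B * MM A B := by
  have p5 : Prime (5 : ℤ) := by norm_num
  obtain ⟨A, B, hP, hQ⟩ := fifth_power P Q n hco h10 h
  have hQ' : Q = 5 * B * MM A B := hQ
  have hAB : IsCoprime A B := by
    refine IsCoprime.of_isCoprime_of_dvd_left (IsCoprime.of_isCoprime_of_dvd_right hco ?_) ?_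
    · rw [hQ]; exact ⟨5 * (A ^ 4 + 10 * A ^ 2 * B ^ 2 + 5 * B ^ 4), by ring⟩
    · rw [hP]; exact Dvd.intro _ rfl
  have hP2 : ¬ Even P := fun hd =>
    not_both_dvd hco 2 Int.prime_two hd.two_dvd (dvd_trans (by norm_num) h10)
  have hP5 : ¬ (5 : ℤ) ∣ P := fun hd =>
    not_both_dvd hco 5 p5 hd (dvd_trans (by norm_num) h10)
  have hodd : Odd (A + B) := by
    rw [hP] at hP2
    rcases Int.even_or_odd A with ha | ha
    · exact absurd (ha.mul_right _) hP2
    · rcases Int.even_or_odd B with hb | hb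
      · exact ha.add_even hb
      · exfalso
        apply hP2
        apply Even.mul_left
        obtain ⟨a, rfl⟩ := ha
        have h1 : Odd (B ^ 4) := hb.pow
        have h2 : Odd ((2 * a + 1) ^ 4) := Odd.pow ⟨a, rfl⟩
        obtain ⟨s, hs⟩ := h1
        obtain ⟨t, ht⟩ := h2
        exact ⟨t + 25 * (2 * a + 1) ^ 2 * B ^ 2 + 125 * s + 63, by rw [hs, ht]; ring⟩
  have hA5 : ¬ (5 : ℤ) ∣ A := fun hd => hP5 (by rw [hP]; exact Dvd.dvd.mul_right hd _)
  have hc30 := MM_coprime_thirty A B hAB hodd hA5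
  have hcB := MM_coprime_right A B hAB
  have hB5 : (5 : ℤ) ∣ B := by
    obtain ⟨c, hc⟩ := h25
    have h1 : (5 : ℤ) ∣ B * MM A B := ⟨c, by linarith⟩
    rcases p5.dvd_or_dvd h1 with h2 | h2
    · exact h2
    · exact (not_both_dvd hc30 5 p5 h2 (by norm_num)).elim
  have hd : 5 * D ∣ 30 ^ (e + 1) := by
    rw [pow_succ, mul_comm]
    exact mul_dvd_mul hD (by norm_num)
  have hcop : IsCoprime (5 * D * B) (MM A B) :=
    (IsCoprime.mul_right ((hc30.pow_right (n := e + 1)).of_isCoprime_of_dvd_right hd) hcB).symm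
  have heq : (5 * D * B) * MM A B = k ^ 5 := by rw [← hDQ, hQ']; ring
  obtain ⟨⟨k', hk'⟩, m, hm⟩ := Int.eq_pow_of_mul_eq_pow_odd hcop (by decide) heq
  exact ⟨A, B, m, 5 * D, k', e + 1, hAB, hodd, hA5, hB5, hm, hd, hk', hQ'⟩

theorem descent (N : ℕ) : ∀ A B m d k : ℤ, ∀ e : ℕ, B.natAbs ≤ N → IsCoprime A B → Odd (A + B) →
    ¬ (5 : ℤ) ∣ A → (5 : ℤ) ∣ B → MM A B = m ^ 5 → d ∣ 30 ^ e → d * B = k ^ 5 → B = 0 := by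
  induction N with
  | zero => intro A B m d k e h; intros; simpa using h
  | succ N ih =>
    intro A B m d k e hN hco ho hA hB hM hd hk
    by_contra hB0
    have p5 : Prime (5 : ℤ) := by norm_num
    obtain ⟨b, hb⟩ := hB
    have hPodd : Odd (A ^ 2 + 5 * B ^ 2) := by
      rcases Int.even_or_odd A with ha | ha
      · have hbo : Odd B := by
          rcases Int.even_or_odd B with h' | h'
          · exact absurd (ha.add h') (Int.not_even_iff_odd.2 ho)
          · exact h'
        exact Even.add_odd (ha.pow_of_ne_zero two_ne_zero) (Odd.mul (by decide) hbo.pow)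
      · have hbo : Even B := by
          rcases Int.even_or_odd B with h' | h'
          · exact h'
          · exact absurd (ha.add_odd h') (Int.not_even_iff_odd.2 ho)
        exact Odd.add_even ha.pow ((hbo.pow_of_ne_zero two_ne_zero).mul_left _)
    have hcop : IsCoprime (A ^ 2 + 5 * B ^ 2) (2 * B ^ 2) := by
      apply IsCoprime.mul_right
      · rw [isCoprime_comm, Int.prime_two.coprime_iff_not_dvd, ← even_iff_two_dvd]
        exact Int.not_even_iff_odd.2 hPodd
      · apply IsCoprime.pow_right
        have h1 : IsCoprime (A ^ 2) B := hco.pow_left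
        have := h1.add_mul_left_left (5 * B)
        rwa [show A ^ 2 + B * (5 * B) = A ^ 2 + 5 * B ^ 2 by ring] at this
    obtain ⟨A', B', m', d', k', e', h1, h2, h3, h4, h5, h6, h7, h8⟩ :=
      descent_step (A ^ 2 + 5 * B ^ 2) (2 * B ^ 2) m (16 * d ^ 2) (2 * k ^ 2) (e * 2 + 4) hcop
        ⟨5 * b ^ 2, by rw [hb]; ring⟩ ⟨2 * b ^ 2, by rw [hb]; ring⟩
        (by rw [← hM]; unfold MM; ring)
        (by
          rw [pow_add, pow_mul, mul_comm]
          exact mul_dvd_mul (pow_dvd_pow_of_dvd hd 2) (by norm_num))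
        (by linear_combination 32 * (d * B + k ^ 5) * hk)
    have hBz : B' ≠ 0 := by
      rintro rfl
      apply hB0
      have : B ^ 2 = 0 := by linarith
      exact pow_eq_zero_iff two_ne_zero |>.1 this
    apply hBz
    refine ih A' B' m' d' k' e' ?_ h1 h2 h3 h4 h5 h6 h7
    have hlt : B' ^ 2 < B ^ 2 := by
      have hab : 1 ≤ |B'| := Int.one_le_abs hBz
      have hMge : 5 * B' ^ 4 ≤ MM A' B' := by unfold MM; nlinarith [sq_nonneg (A' ^ 2), sq_nonneg (A' * B')]
      have h9 : 2 * B ^ 2 = 5 * |B'| * MM A' B' := by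
        have hMp : 0 ≤ MM A' B' := by unfold MM; positivity
        have := congrArg abs h8
        rw [abs_mul, abs_mul, abs_of_nonneg hMp, abs_of_nonneg (by positivity)] at this
        simpa using this
      have h10 : 1 ≤ B' ^ 2 := by rw [← sq_abs]; nlinarith
      nlinarith [mul_le_mul hab hMge (by positivity) (by positivity), sq_nonneg (B' ^ 2)]
    have := sq_lt_sq.1 hlt
    rw [Int.abs_eq_natAbs, Int.abs_eq_natAbs] at this
    omega

theorem fermat_like (x y z c : ℤ) (e : ℕ) (hx : Odd x) (hy : Odd y) (hxy : IsCoprime x y)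
    (hc : c ∣ 30 ^ e) (h5 : (5 : ℤ) ∣ z) (h : x ^ 5 - y ^ 5 = c * z ^ 5) : z = 0 := by
  have p5 : Prime (5 : ℤ) := by norm_num
  obtain ⟨p, hp⟩ := hx.sub_odd hy
  obtain ⟨q, hq⟩ := hx.add_odd hy
  obtain rfl : x = p + q := by linarith
  obtain rfl : y = q - p := by linarith
  have hpq : IsCoprime p q := by
    obtain ⟨a, b, hab⟩ := hxy
    exact ⟨a - b, a + b, by linear_combination hab⟩
  have h1 : 2 * p * (p ^ 4 + 10 * p ^ 2 * q ^ 2 + 5 * q ^ 4) = c * z ^ 5 := by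
    rw [← h]; ring
  obtain ⟨w, rfl⟩ := h5
  have hp5 : (5 : ℤ) ∣ p := by
    have : (5 : ℤ) ∣ 2 * p ^ 5 :=
      ⟨625 * c * w ^ 5 - 2 * p * (2 * p ^ 2 * q ^ 2 + q ^ 4), by linear_combination h1⟩
    rcases p5.dvd_or_dvd this with h' | h'
    · norm_num at h'
    · exact p5.dvd_of_dvd_pow h'
  obtain ⟨r, rfl⟩ := hp5
  have hq5 : ¬ (5 : ℤ) ∣ q := fun hd => not_both_dvd hpq 5 p5 (Dvd.intro _ rfl) hd
  have hrq : IsCoprime r q := hpq.of_mul_left_right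
  set N := q ^ 4 + 50 * q ^ 2 * r ^ 2 + 125 * r ^ 4 with hN
  have hN5 : ¬ (5 : ℤ) ∣ N := by
    intro hd
    have := dvd_sub hd (Dvd.intro (10 * q ^ 2 * r ^ 2 + 25 * r ^ 4) rfl)
    rw [show N - 5 * (10 * q ^ 2 * r ^ 2 + 25 * r ^ 4) = q ^ 4 by rw [hN]; ring] at this
    exact hq5 (p5.dvd_of_dvd_pow this)
  have h2 : 2 * r * N = 125 * (c * w ^ 5) := by
    have : 25 * (2 * r * N) = 25 * (125 * (c * w ^ 5)) := by rw [hN]; linear_combination h1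
    linarith
  have hr5 : (5 : ℤ) ∣ r := by
    have : (5 : ℤ) ∣ 2 * r * N := ⟨25 * (c * w ^ 5), by rw [h2]; ring⟩
    rcases p5.dvd_or_dvd this with h' | h'
    · rcases p5.dvd_or_dvd h' with h' | h'
      · norm_num at h'
      · exact h'
    · exact absurd h' hN5
  have hodd : Odd (q + r) := by
    obtain ⟨t, ht⟩ := hx
    exact ⟨t - 2 * r, by linarith⟩
  have hPodd : Odd (q ^ 2 + 25 * r ^ 2) := by
    obtain ⟨t, ht⟩ := hodd
    obtain rfl : q = 2 * t + 1 - r := by linarith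
    exact ⟨2 * t ^ 2 + 2 * t - 2 * t * r - r + 13 * r ^ 2, by ring⟩
  have hcop : IsCoprime (q ^ 2 + 25 * r ^ 2) (10 * r ^ 2) := by
    rw [show (10 : ℤ) = 2 * 5 by norm_num]
    refine IsCoprime.mul_right (IsCoprime.mul_right ?_ ?_) (IsCoprime.pow_right ?_)
    · rw [isCoprime_comm, Int.prime_two.coprime_iff_not_dvd, ← even_iff_two_dvd]
      exact Int.not_even_iff_odd.2 hPodd
    · rw [isCoprime_comm, p5.coprime_iff_not_dvd]
      intro hd
      have := dvd_sub hd (Dvd.intro (5 * r ^ 2) rfl)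
      rw [show q ^ 2 + 25 * r ^ 2 - 5 * (5 * r ^ 2) = q ^ 2 by ring] at this
      exact hq5 (p5.dvd_of_dvd_pow this)
    · have h' : IsCoprime (q ^ 2) r := hrq.symm.pow_left
      have := h'.add_mul_left_left (25 * r)
      rwa [show q ^ 2 + r * (25 * r) = q ^ 2 + 25 * r ^ 2 by ring] at this
  -- `N` is coprime to `30` and `r`
  have hNr : IsCoprime N r := by
    have h' : IsCoprime (q ^ 4) r := hrq.symm.pow_left
    have := h'.add_mul_left_left (50 * q ^ 2 * r + 125 * r ^ 3)
    rwa [show q ^ 4 + r * (50 * q ^ 2 * r + 125 * r ^ 3) = N by rw [hN]; ring] at this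
  have hN30 : IsCoprime N 30 := by
    apply coprime_thirty _ _ _ hN5
    · intro hd
      have h' : (2 : ℤ) ∣ (q ^ 2 + 25 * r ^ 2) ^ 2 := by
        have := dvd_add hd (Dvd.intro (250 * r ^ 4) rfl)
        rwa [show N + 2 * (250 * r ^ 4) = (q ^ 2 + 25 * r ^ 2) ^ 2 by rw [hN]; ring] at this
      have := Int.prime_two.dvd_of_dvd_pow h'
      rw [← even_iff_two_dvd] at this
      exact Int.not_even_iff_odd.2 hPodd this
    · intro hd
      have h1 := (ZMod.intCast_zmod_eq_zero_iff_dvd N 3).2 (by exact_mod_cast hd)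
      rw [hN] at h1
      push_cast at h1
      have h10 : (50 : ZMod 3) = 2 := by decide
      have h55 : (125 : ZMod 3) = 2 := by decide
      rw [h10, h55] at h1
      have key : ∀ a b : ZMod 3, a ^ 4 + 2 * a ^ 2 * b ^ 2 + 2 * b ^ 4 = 0 → a = 0 ∧ b = 0 := by
        decide
      obtain ⟨ha, hb⟩ := key _ _ h1
      rw [ZMod.intCast_zmod_eq_zero_iff_dvd] at ha hb
      exact not_both_dvd hrq 3 (by norm_num) (by exact_mod_cast hb) (by exact_mod_cast ha)
  have hcd : 50 * c ^ 4 ∣ 30 ^ (e * 4 + 2) := by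
    rw [pow_add, pow_mul, mul_comm]
    exact mul_dvd_mul (pow_dvd_pow_of_dvd hc 4) (by norm_num)
  have hcop2 : IsCoprime (50 * c ^ 4 * r) N :=
    (IsCoprime.mul_right ((hN30.pow_right (n := e * 4 + 2)).of_isCoprime_of_dvd_right hcd) hNr).symm
  have heq : 50 * c ^ 4 * r * N = (5 * c * w) ^ 5 := by
    linear_combination 25 * c ^ 4 * h2
  obtain ⟨⟨k, hk⟩, n, hn⟩ := Int.eq_pow_of_mul_eq_pow_odd hcop2 (by decide) heq
  obtain ⟨s, hs⟩ := hr5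
  obtain ⟨A, B, m', d', k', e', g1, g2, g3, g4, g5, g6, g7, g8⟩ :=
    descent_step (q ^ 2 + 25 * r ^ 2) (10 * r ^ 2) n (10 ^ 4 * (50 * c ^ 4) ^ 2) (10 * k ^ 2)
      ((e * 4 + 2) * 2 + 4) hcop
      (Dvd.intro _ rfl) ⟨10 * s ^ 2, by rw [hs]; ring⟩
      (by rw [← hn, hN]; ring)
      (by
        rw [pow_add, pow_mul, mul_comm]
        exact mul_dvd_mul (pow_dvd_pow_of_dvd hcd 2) (by norm_num))
      (by linear_combination 10 ^ 5 * (50 * c ^ 4 * r + k ^ 5) * hk)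
  have hB := descent B.natAbs A B m' d' k' e' le_rfl g1 g2 g3 g4 g5 g6 g7
  rw [hB] at g8
  have hr : r = 0 := by
    have : r ^ 2 = 0 := by linarith
    exact pow_eq_zero_iff two_ne_zero |>.1 this
  rw [hr] at h2
  have h3 : c * w ^ 5 = 0 := by linarith
  rcases mul_eq_zero.1 h3 with h' | h'
  · rw [h'] at hc
    exact absurd (zero_dvd_iff.1 hc) (by positivity)
  · rw [pow_eq_zero_iff (by norm_num)] at h'
    rw [h']; ring

/-- The fifth powers modulo `25`. -/
def T25 : Finset (ZMod 25) := {0, 1, -1, 7, -7}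

set_option maxRecDepth 100000 in
theorem pow_mem_T25 : ∀ x : ZMod 25, x ^ 5 ∈ T25 := by decide

theorem five_dvd_of_pow (r : ℤ) (h : (r : ZMod 25) ^ 5 = 0) : (5 : ℤ) ∣ r := by
  have h1 : ((r ^ 5 : ℤ) : ZMod 25) = 0 := by push_cast; exact h
  rw [ZMod.intCast_zmod_eq_zero_iff_dvd] at h1
  have h2 : (5 : ℤ) ∣ r ^ 5 := dvd_trans (by norm_num) h1
  exact (by norm_num : Prime (5 : ℤ)).dvd_of_dvd_pow h2

theorem not_both_pow {r s : ℤ} (h : IsCoprime r s) (hr : (r : ZMod 25) ^ 5 = 0)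
    (hs : (s : ZMod 25) ^ 5 = 0) : False :=
  not_both_dvd h 5 (by norm_num) (five_dvd_of_pow r hr) (five_dvd_of_pow s hs)

set_option maxRecDepth 100000 in
theorem loc1 : ∀ q ∈ T25, ∀ a ∈ T25, ∀ s ∈ T25, q + 72 * a = s → a = 0 := by decide

set_option synthInstance.maxHeartbeats 400000 in
set_option maxRecDepth 100000 in
theorem loc1_aux : ∀ s ∈ T25, ∀ r ∈ T25,
    ((∃ a ∈ T25, s - r = 16 * a) ∧ (∃ b ∈ T25, s + r = 18 * b)) → (s = 0 ∧ r = 0) := by decide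

theorem loc1' : ∀ s ∈ T25, ∀ r ∈ T25, ∀ a ∈ T25, s - r = 16 * a → ∀ b ∈ T25, s + r = 18 * b →
    s = 0 ∧ r = 0 :=
  fun s hs r hr a ha h1 b hb h2 => loc1_aux s hs r hr ⟨⟨a, ha, h1⟩, ⟨b, hb, h2⟩⟩

set_option synthInstance.maxHeartbeats 400000 in
set_option maxRecDepth 100000 in
theorem loc2_aux : ∀ r ∈ T25, ∀ s ∈ T25,
    ((∃ y ∈ T25, r + s = 9 * y) ∧ (∃ x ∈ T25, r - s = x)) → (r = 0 ∧ s = 0) := by decide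

theorem loc2 : ∀ r ∈ T25, ∀ s ∈ T25, ∀ y ∈ T25, r + s = 9 * y → ∀ x ∈ T25, r - s = x →
    r = 0 ∧ s = 0 :=
  fun r hr s hs y hy h1 x hx h2 => loc2_aux r hr s hs ⟨⟨y, hy, h1⟩, ⟨x, hx, h2⟩⟩

set_option synthInstance.maxHeartbeats 400000 in
set_option maxRecDepth 100000 in
theorem loc3 : ∀ q ∈ T25, ∀ p ∈ T25, ∀ s ∈ T25, q + 8 * p = 27 * s → ∀ r ∈ T25, q - 8 * p = r →
    s = 0 ∧ r = 0 := by decide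

set_option maxRecDepth 100000 in
theorem loc4 : ∀ s ∈ T25, ∀ r ∈ T25, ∀ p ∈ T25, s - r = 54 * p → p = 0 := by decide

theorem cast25 {a b : ℤ} (h : a = b) : (a : ZMod 25) = (b : ZMod 25) := by rw [h]

theorem split_pow {p m n : ℤ} (hp : Prime p) (h : IsCoprime m n) (k : ℕ) (hd : p ^ k ∣ m * n) :
    p ^ k ∣ m ∨ p ^ k ∣ n := by
  by_cases h1 : p ∣ m
  · left
    refine hp.pow_dvd_of_dvd_mul_right k ?_ hd
    exact fun h2 => not_both_dvd h p hp h1 h2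
  · right
    exact hp.pow_dvd_of_dvd_mul_left k h1 hd

theorem odd_of_pow {s : ℤ} (h : Odd (s ^ 5)) : Odd s := by
  rw [Int.odd_pow' (by norm_num)] at h
  exact h

theorem coprime_sum_diff {m n : ℤ} (h : IsCoprime m n) (ho : Odd (m + n)) :
    IsCoprime (m + n) (m - n) := by
  have h2 : IsCoprime (m + n) 2 := by
    rw [isCoprime_comm, Int.prime_two.coprime_iff_not_dvd, ← even_iff_two_dvd]
    exact Int.not_even_iff_odd.2 ho
  have h3 : IsCoprime (m + n) n := by
    have := h.add_mul_left_left 1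
    rwa [mul_one] at this
  have h4 := (h2.mul_right h3).neg_right.add_mul_left_right 1
  rwa [show -(2 * n) + (m + n) * 1 = m - n by ring] at h4

theorem odd_diff {m n : ℤ} (ho : Odd (m + n)) : Odd (m - n) := by
  obtain ⟨t, ht⟩ := ho
  exact ⟨t - n, by linarith⟩

theorem case1_aux (m n s r u : ℤ) (hmn : IsCoprime m n) (ho : Odd (m + n)) (hs : m + n = s ^ 5)
    (hr : m - n = r ^ 5) (h : m * n = 72 * u ^ 5) (h8 : (8 : ℤ) ∣ n) : u = 0 := by
  have hsr : IsCoprime s r := by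
    have := coprime_sum_diff hmn ho
    rw [hs, hr] at this
    exact (IsCoprime.pow_iff (by norm_num) (by norm_num)).1 this
  have hso : Odd s := odd_of_pow (hs ▸ ho)
  have hro : Odd r := odd_of_pow (hr ▸ odd_diff ho)
  obtain ⟨n', rfl⟩ := h8
  have h1 : m * n' = 9 * u ^ 5 := by linarith
  have hmn' : IsCoprime m n' := hmn.of_mul_right_right
  rcases split_pow (by norm_num : Prime (3 : ℤ)) hmn' 2 ⟨u ^ 5, by rw [h1]; norm_num⟩ with h9 | h9
  · obtain ⟨m', rfl⟩ := h9
    have h2 : m' * n' = u ^ 5 := by linarith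
    obtain ⟨⟨b, hb⟩, a, ha⟩ :=
      Int.eq_pow_of_mul_eq_pow_odd hmn'.of_mul_left_right (by decide) h2
    exfalso
    have e1 : s ^ 5 - r ^ 5 = 16 * a ^ 5 := by rw [← hs, ← hr, ← ha]; ring
    have e2 : s ^ 5 + r ^ 5 = 18 * b ^ 5 := by rw [← hs, ← hr, ← hb]; ring
    have c1 := cast25 e1
    have c2 := cast25 e2
    push_cast at c1 c2
    obtain ⟨z1, z2⟩ := loc1' _ (pow_mem_T25 s) _ (pow_mem_T25 r) _ (pow_mem_T25 a) c1 _
      (pow_mem_T25 b) c2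
    exact not_both_pow hsr z1 z2
  · obtain ⟨n'', rfl⟩ := h9
    have h2 : m * n'' = u ^ 5 := by linarith
    obtain ⟨⟨q, hq⟩, a, ha⟩ :=
      Int.eq_pow_of_mul_eq_pow_odd hmn'.of_mul_right_right (by decide) h2
    have e1 : q ^ 5 + 72 * a ^ 5 = s ^ 5 := by rw [← hs, ← hq, ← ha]; ring
    have e2 : s ^ 5 - r ^ 5 = 144 * a ^ 5 := by rw [← hs, ← hr, ← ha]; ring
    have c1 := cast25 e1
    push_cast at c1
    have h5 := five_dvd_of_pow a
      (loc1 _ (pow_mem_T25 q) _ (pow_mem_T25 a) _ (pow_mem_T25 s) c1)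
    have ha0 := fermat_like s r a 144 4 hso hro hsr (by norm_num) h5 e2
    rw [ha, ha0] at h2
    have : u ^ 5 = 0 := by rw [← h2]; ring
    exact pow_eq_zero_iff (by norm_num) |>.1 this

theorem case1 (m n u v : ℤ) (hmn : IsCoprime m n) (ho : Odd (m + n)) (h1 : v ^ 5 = m ^ 2 - n ^ 2)
    (h2 : 144 * u ^ 5 = 2 * m * n) : u = 0 := by
  obtain ⟨⟨s, hs⟩, r, hr⟩ := Int.eq_pow_of_mul_eq_pow_odd (c := v) (coprime_sum_diff hmn ho)
    (by decide : Odd 5) (by rw [h1]; ring)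
  have h3 : m * n = 72 * u ^ 5 := by linarith
  rcases split_pow Int.prime_two hmn 3 ⟨9 * u ^ 5, by rw [h3]; ring⟩ with h8 | h8
  · exact case1_aux n m s (-r) u hmn.symm (by rwa [add_comm]) (by rw [← hs]; ring)
      (by rw [Odd.neg_pow (by decide), ← hr]; ring) (by rw [← h3]; ring) (by norm_num at h8; exact h8)
  · exact case1_aux m n s r u hmn ho hs hr h3 (by norm_num at h8; exact h8)

theorem case2_aux (m n u v : ℤ) (hmn : IsCoprime m n) (ho : Odd (m + n))
    (h1 : 9 * u ^ 5 = m ^ 2 - n ^ 2) (h2 : m * n = v ^ 5) (h9 : (9 : ℤ) ∣ m + n) : False := by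
  obtain ⟨⟨r, hr⟩, s, hs⟩ := Int.eq_pow_of_mul_eq_pow_odd hmn (by decide : Odd 5) h2
  have hc := coprime_sum_diff hmn ho
  obtain ⟨g, hg⟩ := h9
  rw [hg] at hc
  have h3 : g * (m - n) = u ^ 5 := by
    have : 9 * (g * (m - n)) = 9 * u ^ 5 := by rw [h1, ← mul_assoc, ← hg]; ring
    linarith
  obtain ⟨⟨y, hy⟩, x, hx⟩ :=
    Int.eq_pow_of_mul_eq_pow_odd hc.of_mul_left_right (by decide : Odd 5) h3
  have c1 := cast25 (show r ^ 5 + s ^ 5 = 9 * y ^ 5 by rw [← hr, ← hs, ← hy, hg])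
  have c2 := cast25 (show r ^ 5 - s ^ 5 = x ^ 5 by rw [← hr, ← hs, ← hx])
  push_cast at c1 c2
  obtain ⟨z1, z2⟩ := loc2 _ (pow_mem_T25 r) _ (pow_mem_T25 s) _ (pow_mem_T25 y) c1 _
    (pow_mem_T25 x) c2
  have hrs : IsCoprime r s := by
    rw [hr, hs] at hmn
    exact (IsCoprime.pow_iff (by norm_num) (by norm_num)).1 hmn
  exact not_both_pow hrs z1 z2

theorem case2 (m n u v : ℤ) (hmn : IsCoprime m n) (ho : Odd (m + n))
    (h1 : 9 * u ^ 5 = m ^ 2 - n ^ 2) (h2 : 2 * v ^ 5 = 2 * m * n) : False := by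
  have h3 : m * n = v ^ 5 := by linarith
  rcases split_pow (by norm_num : Prime (3 : ℤ)) (coprime_sum_diff hmn ho) 2
    ⟨u ^ 5, by linear_combination -h1⟩ with h9 | h9
  · exact case2_aux m n u v hmn ho h1 h3 (by norm_num at h9; exact h9)
  · exact case2_aux m (-n) u (-v) hmn.neg_right (by rw [← sub_eq_add_neg]; exact odd_diff ho)
      (by rw [h1]; ring) (by rw [Odd.neg_pow (by decide), ← h3]; ring)
      (by rw [← sub_eq_add_neg]; norm_num at h9; exact h9)

theorem case3_aux (m n u v : ℤ) (hmn : IsCoprime m n) (ho : Odd (m + n))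
    (h1 : 27 * v ^ 5 = m ^ 2 - n ^ 2) (h2 : m * n = 8 * u ^ 5) (h27 : (27 : ℤ) ∣ m + n) : False := by
  have hc := coprime_sum_diff hmn ho
  obtain ⟨g, hg⟩ := h27
  rw [hg] at hc
  have h3 : g * (m - n) = v ^ 5 := by
    have : 27 * (g * (m - n)) = 27 * v ^ 5 := by rw [h1, ← mul_assoc, ← hg]; ring
    linarith
  obtain ⟨⟨s, hs⟩, r, hr⟩ :=
    Int.eq_pow_of_mul_eq_pow_odd hc.of_mul_left_right (by decide : Odd 5) h3
  have hsr : IsCoprime s r := by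
    have := hc.of_mul_left_right
    rw [hs, hr] at this
    exact (IsCoprime.pow_iff (by norm_num) (by norm_num)).1 this
  rcases split_pow Int.prime_two hmn 3 ⟨u ^ 5, by rw [h2]; norm_num⟩ with h8 | h8
  · obtain ⟨m', rfl⟩ := h8
    obtain ⟨⟨p, hp⟩, q, hq⟩ := Int.eq_pow_of_mul_eq_pow_odd (c := u) hmn.of_mul_left_right
      (by decide : Odd 5) (by linarith)
    have c1 := cast25 (show q ^ 5 + 8 * p ^ 5 = 27 * s ^ 5 by rw [← hp, ← hq, ← hs, ← hg]; ring)
    have c2 := cast25 (show q ^ 5 - 8 * p ^ 5 = (-r) ^ 5 by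
      rw [Odd.neg_pow (by decide), ← hp, ← hq, ← hr]; ring)
    push_cast at c1 c2
    obtain ⟨z1, z2⟩ := loc3 _ (pow_mem_T25 q) _ (pow_mem_T25 p) _ (pow_mem_T25 s) c1 _
      (pow_mem_T25 (-r)) c2
    exact not_both_pow hsr.neg_right z1 (by push_cast; exact z2)
  · obtain ⟨n', rfl⟩ := h8
    obtain ⟨⟨q, hq⟩, p, hp⟩ := Int.eq_pow_of_mul_eq_pow_odd (c := u) hmn.of_mul_right_right
      (by decide : Odd 5) (by linarith)
    have c1 := cast25 (show q ^ 5 + 8 * p ^ 5 = 27 * s ^ 5 by rw [← hp, ← hq, ← hs, ← hg]; ring)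
    have c2 := cast25 (show q ^ 5 - 8 * p ^ 5 = r ^ 5 by rw [← hp, ← hq, ← hr]; ring)
    push_cast at c1 c2
    obtain ⟨z1, z2⟩ := loc3 _ (pow_mem_T25 q) _ (pow_mem_T25 p) _ (pow_mem_T25 s) c1 _
      (pow_mem_T25 r) c2
    exact not_both_pow hsr z1 z2

theorem case3 (m n u v : ℤ) (hmn : IsCoprime m n) (ho : Odd (m + n))
    (h1 : 27 * v ^ 5 = m ^ 2 - n ^ 2) (h2 : 16 * u ^ 5 = 2 * m * n) : False := by
  have h3 : m * n = 8 * u ^ 5 := by linarith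
  rcases split_pow (by norm_num : Prime (3 : ℤ)) (coprime_sum_diff hmn ho) 3
    ⟨v ^ 5, by linear_combination -h1⟩ with h9 | h9
  · exact case3_aux m n u v hmn ho h1 h3 (by norm_num at h9; exact h9)
  · exact case3_aux m (-n) (-u) v hmn.neg_right (by rw [← sub_eq_add_neg]; exact odd_diff ho)
      (by rw [h1]; ring) (by rw [Odd.neg_pow (by decide)]; linear_combination -h3)
      (by rw [← sub_eq_add_neg]; norm_num at h9; exact h9)

theorem case4_aux (m n s r v : ℤ) (hmn : IsCoprime m n) (ho : Odd (m + n)) (hs : m + n = s ^ 5)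
    (hr : m - n = r ^ 5) (h : m * n = 27 * v ^ 5) (h27 : (27 : ℤ) ∣ n) : v = 0 := by
  have hsr : IsCoprime s r := by
    have := coprime_sum_diff hmn ho
    rw [hs, hr] at this
    exact (IsCoprime.pow_iff (by norm_num) (by norm_num)).1 this
  have hso : Odd s := odd_of_pow (hs ▸ ho)
  have hro : Odd r := odd_of_pow (hr ▸ odd_diff ho)
  obtain ⟨n', rfl⟩ := h27
  have h2 : m * n' = v ^ 5 := by linarith
  obtain ⟨p, hp⟩ :=
    Int.eq_pow_of_mul_eq_pow_odd_right hmn.of_mul_right_right (by decide : Odd 5) h2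
  have e2 : s ^ 5 - r ^ 5 = 54 * p ^ 5 := by rw [← hs, ← hr, ← hp]; ring
  have c1 := cast25 e2
  push_cast at c1
  have h5 := five_dvd_of_pow p
    (loc4 _ (pow_mem_T25 s) _ (pow_mem_T25 r) _ (pow_mem_T25 p) c1)
  have ha0 := fermat_like s r p 54 3 hso hro hsr (by norm_num) h5 e2
  rw [hp, ha0] at h2
  have : v ^ 5 = 0 := by rw [← h2]; ring
  exact pow_eq_zero_iff (by norm_num) |>.1 this

theorem case4 (m n u v : ℤ) (hmn : IsCoprime m n) (ho : Odd (m + n)) (h1 : u ^ 5 = m ^ 2 - n ^ 2)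
    (h2 : 54 * v ^ 5 = 2 * m * n) : v = 0 := by
  obtain ⟨⟨s, hs⟩, r, hr⟩ := Int.eq_pow_of_mul_eq_pow_odd (c := u) (coprime_sum_diff hmn ho)
    (by decide : Odd 5) (by rw [h1]; ring)
  have h3 : m * n = 27 * v ^ 5 := by linarith
  rcases split_pow (by norm_num : Prime (3 : ℤ)) hmn 3 ⟨v ^ 5, by rw [h3]; norm_num⟩ with h8 | h8
  · exact case4_aux n m s (-r) v hmn.symm (by rwa [add_comm]) (by rw [← hs]; ring)
      (by rw [Odd.neg_pow (by decide), ← hr]; ring) (by rw [← h3]; ring) (by norm_num at h8; exact h8)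
  · exact case4_aux m n s r v hmn ho hs hr h3 (by norm_num at h8; exact h8)

theorem coprime_F2 (W V k : ℤ) (hco : IsCoprime W V) (ho : Odd (W + V)) (hk : k ∣ W ^ 2 + V ^ 2)
    (h5 : ¬ (5 : ℤ) ∣ k) : IsCoprime k
      (W ^ 4 + 522 * W ^ 3 * V - 10006 * W ^ 2 * V ^ 2 - 522 * W * V ^ 3 + V ^ 4) := by
  have p5 : Prime (5 : ℤ) := by norm_num
  have hV : IsCoprime k V := by
    have h1 : IsCoprime (W ^ 2) V := hco.pow_left
    have := h1.add_mul_left_left V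
    rw [show W ^ 2 + V * V = W ^ 2 + V ^ 2 by ring] at this
    exact this.of_isCoprime_of_dvd_left hk
  have h30 : IsCoprime k 30 := by
    apply coprime_thirty k _ _ h5
    · intro hd
      obtain ⟨t, ht⟩ := ho
      obtain ⟨c, hc⟩ := dvd_trans hd hk
      obtain rfl : W = 2 * t + 1 - V := by linarith
      have : 2 * (c - (2 * t ^ 2 + 2 * t - 2 * t * V - V + V ^ 2)) = 1 := by
        linear_combination -hc
      omega
    · intro hd
      have h1 := (ZMod.intCast_zmod_eq_zero_iff_dvd (W ^ 2 + V ^ 2) 3).2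
        (by exact_mod_cast (dvd_trans hd hk))
      push_cast at h1
      have key : ∀ a b : ZMod 3, a ^ 2 + b ^ 2 = 0 → a = 0 ∧ b = 0 := by decide
      obtain ⟨ha, hb⟩ := key _ _ h1
      rw [ZMod.intCast_zmod_eq_zero_iff_dvd] at ha hb
      exact not_both_dvd hco 3 (by norm_num) (by exact_mod_cast ha) (by exact_mod_cast hb)
  have h1 : IsCoprime k (36 * 5 ^ 7 * V ^ 5) := by
    refine IsCoprime.mul_right ?_ hV.pow_right
    exact (h30.pow_right (n := 9)).of_isCoprime_of_dvd_right (by norm_num)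
  obtain ⟨c, hc⟩ := hk
  have h2 := h1.add_mul_left_right
    (c * ((W ^ 2 + 522 * W * V - 10007 * V ^ 2) * (278 * V + 29 * W) - 36 * 29 ^ 2 * V ^ 3))
  have e : 36 * 5 ^ 7 * V ^ 5 + k * (c * ((W ^ 2 + 522 * W * V - 10007 * V ^ 2) *
      (278 * V + 29 * W) - 36 * 29 ^ 2 * V ^ 3)) =
      (W ^ 4 + 522 * W ^ 3 * V - 10006 * W ^ 2 * V ^ 2 - 522 * W * V ^ 3 + V ^ 4) *
        (278 * V + 29 * W) := by
    rw [← mul_assoc, ← hc]; ring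
  rw [e] at h2
  exact h2.of_mul_right_left

theorem square_F1 (W V z : ℤ) (hco : IsCoprime W V) (ho : Odd (W + V))
    (hloc : ∀ s : ℤ, ¬ (25 : ℤ) ∣ W ^ 2 + V ^ 2 - 5 * s ^ 2)
    (h : (W ^ 2 + V ^ 2) *
      (W ^ 4 + 522 * W ^ 3 * V - 10006 * W ^ 2 * V ^ 2 - 522 * W * V ^ 3 + V ^ 4) = z ^ 2) :
    ∃ a : ℤ, W ^ 2 + V ^ 2 = a ^ 2 := by
  have hpos : 0 < W ^ 2 + V ^ 2 := by
    rcases eq_or_ne W 0 with h0 | h0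
    · rcases eq_or_ne V 0 with h1 | h1
      · subst h0 h1; simp at ho
      · positivity
    · positivity
  by_cases h5 : (5 : ℤ) ∣ W ^ 2 + V ^ 2
  · exfalso
    obtain ⟨k, hk⟩ := h5
    have hk5 : ¬ (5 : ℤ) ∣ k := by
      rintro ⟨c, rfl⟩
      exact hloc 0 ⟨c, by rw [hk]; ring⟩
    have h1 := coprime_F2 W V k hco ho ⟨5, by rw [hk]; ring⟩ hk5
    have h2 : IsCoprime k 5 := ((by norm_num : Prime (5 : ℤ)).coprime_iff_not_dvd.2 hk5).symm
    obtain ⟨a, ha | ha⟩ := Int.sq_of_isCoprime (h2.mul_right h1) (c := z) (by rw [← h, hk]; ring)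
    · exact hloc a ⟨0, by rw [hk, ha]; ring⟩
    · nlinarith [sq_nonneg a]
  · obtain ⟨a, ha | ha⟩ := Int.sq_of_isCoprime (coprime_F2 W V _ hco ho dvd_rfl h5) h
    · exact ⟨a, ha⟩
    · nlinarith [sq_nonneg a]

theorem pyth (O E a : ℤ) (h : O ^ 2 + E ^ 2 = a ^ 2) (hco : IsCoprime O E) (ho : Odd O) :
    ∃ m n : ℤ, O = m ^ 2 - n ^ 2 ∧ E = 2 * m * n ∧ IsCoprime m n ∧ Odd (m + n) := by
  obtain ⟨m, n, h1, -, h3, h4⟩ := PythagoreanTriple.coprime_classification.1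
    (⟨by unfold PythagoreanTriple; linarith, Int.isCoprime_iff_gcd_eq_one.1 hco⟩ :
      PythagoreanTriple O E a ∧ Int.gcd O E = 1)
  refine ⟨m, n, ?_, ?_, Int.isCoprime_iff_gcd_eq_one.2 h3, by rw [Int.odd_iff]; omega⟩
  · rcases h1 with h1 | h1
    · exact h1.1
    · exfalso
      rw [h1.1, mul_assoc] at ho
      exact Int.not_even_iff_odd.2 ho (even_two_mul _)
  · rcases h1 with h1 | h1
    · exact h1.2
    · exfalso
      rw [h1.1, mul_assoc] at ho
      exact Int.not_even_iff_odd.2 ho (even_two_mul _)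

theorem hloc_of (c d : ℤ) (u v : ℤ) (huv : IsCoprime u v)
    (H : ∀ a ∈ T25, ∀ b ∈ T25, ∀ s : ZMod 25, ((c : ZMod 25) * a) ^ 2 + ((d : ZMod 25) * b) ^ 2 = 5 * s ^ 2 →
      a = 0 ∧ b = 0) (s : ℤ) : ¬ (25 : ℤ) ∣ (c * u ^ 5) ^ 2 + (d * v ^ 5) ^ 2 - 5 * s ^ 2 := by
  intro hd
  have h1 := (ZMod.intCast_zmod_eq_zero_iff_dvd
    ((c * u ^ 5) ^ 2 + (d * v ^ 5) ^ 2 - 5 * s ^ 2) 25).2 (by exact_mod_cast hd)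
  push_cast at h1
  obtain ⟨z1, z2⟩ := H _ (pow_mem_T25 u) _ (pow_mem_T25 v) s (sub_eq_zero.1 h1)
  exact not_both_pow huv z1 z2

theorem exists_root (y g X : ℤ) (hg : g ≠ 0) (h : y ^ 2 = g ^ 2 * X) : ∃ z, X = z ^ 2 := by
  have h1 : g ^ 2 ∣ y ^ 2 := ⟨X, h⟩
  rw [Int.pow_dvd_pow_iff two_ne_zero] at h1
  obtain ⟨z, rfl⟩ := h1
  refine ⟨z, ?_⟩
  have : g ^ 2 * (X - z ^ 2) = 0 := by linear_combination -h
  rcases mul_eq_zero.1 this with h2 | h2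
  · exact absurd (pow_eq_zero_iff two_ne_zero |>.1 h2) hg
  · linarith

theorem param (c d g u v y : ℤ) (hg : g ≠ 0) (huv : IsCoprime u v)
    (hco : IsCoprime (c * u ^ 5) (d * v ^ 5)) (ho : Odd (c * u ^ 5 + d * v ^ 5))
    (H : ∀ a ∈ T25, ∀ b ∈ T25, ∀ s : ZMod 25, ((c : ZMod 25) * a) ^ 2 + ((d : ZMod 25) * b) ^ 2 = 5 * s ^ 2 →
      a = 0 ∧ b = 0)
    (h : y ^ 2 = (g ^ 3) ^ 2 * (((c * u ^ 5) ^ 2 + (d * v ^ 5) ^ 2) *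
      ((c * u ^ 5) ^ 4 + 522 * (c * u ^ 5) ^ 3 * (d * v ^ 5)
        - 10006 * (c * u ^ 5) ^ 2 * (d * v ^ 5) ^ 2
        - 522 * (c * u ^ 5) * (d * v ^ 5) ^ 3 + (d * v ^ 5) ^ 4))) :
    ∃ a : ℤ, (c * u ^ 5) ^ 2 + (d * v ^ 5) ^ 2 = a ^ 2 := by
  obtain ⟨z, hz⟩ := exists_root _ _ _ (pow_ne_zero 3 hg) h
  exact square_F1 _ _ z hco ho (hloc_of c d u v huv H) hz

set_option maxRecDepth 100000 in
theorem H1 : ∀ a ∈ T25, ∀ b ∈ T25, ∀ s : ZMod 25,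
    (((144 : ℤ) : ZMod 25) * a) ^ 2 + (((1 : ℤ) : ZMod 25) * b) ^ 2 = 5 * s ^ 2 → a = 0 ∧ b = 0 := by
  decide

set_option maxRecDepth 100000 in
theorem H2 : ∀ a ∈ T25, ∀ b ∈ T25, ∀ s : ZMod 25,
    (((9 : ℤ) : ZMod 25) * a) ^ 2 + (((2 : ℤ) : ZMod 25) * b) ^ 2 = 5 * s ^ 2 → a = 0 ∧ b = 0 := by
  decide

set_option maxRecDepth 100000 in
theorem H3 : ∀ a ∈ T25, ∀ b ∈ T25, ∀ s : ZMod 25,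
    (((16 : ℤ) : ZMod 25) * a) ^ 2 + (((27 : ℤ) : ZMod 25) * b) ^ 2 = 5 * s ^ 2 → a = 0 ∧ b = 0 := by
  decide

set_option maxRecDepth 100000 in
theorem H4 : ∀ a ∈ T25, ∀ b ∈ T25, ∀ s : ZMod 25,
    (((1 : ℤ) : ZMod 25) * a) ^ 2 + (((54 : ℤ) : ZMod 25) * b) ^ 2 = 5 * s ^ 2 → a = 0 ∧ b = 0 := by
  decide

theorem coprime_consts {c d u v : ℤ} (huv : IsCoprime u v) (hcd : IsCoprime c d)
    (hcv : IsCoprime c v) (hud : IsCoprime u d) : IsCoprime (c * u ^ 5) (d * v ^ 5) :=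
  IsCoprime.mul_left (hcd.mul_right hcv.pow_right) ((hud.pow_left).mul_right huv.pow)

theorem uv_zero (u v y : ℤ) (huv : IsCoprime u v)
    (h : y ^ 2 =
      (20736 * u ^ 10 + v ^ 10) *
        (429981696 * u ^ 20 + 1558683648 * u ^ 15 * v ^ 5
          - 207484416 * u ^ 10 * v ^ 10 - 75168 * u ^ 5 * v ^ 15 + v ^ 20)) :
    u = 0 ∨ v = 0 := by
  have p2 := Int.prime_two
  have p3 : Prime (3 : ℤ) := by norm_num
  have co2 : ∀ {x : ℤ}, ¬ (2 : ℤ) ∣ x → IsCoprime 2 x := fun hx => p2.coprime_iff_not_dvd.2 hx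
  have co3 : ∀ {x : ℤ}, ¬ (3 : ℤ) ∣ x → IsCoprime 3 x := fun hx => p3.coprime_iff_not_dvd.2 hx
  have oddof : ∀ {x : ℤ}, ¬ (2 : ℤ) ∣ x → Odd x := fun hx => by
    rw [← Int.not_even_iff_odd, even_iff_two_dvd]; exact hx
  by_cases h2 : (2 : ℤ) ∣ v <;> by_cases h3 : (3 : ℤ) ∣ v
  · -- both
    have hu2 : ¬ (2 : ℤ) ∣ u := fun hd => not_both_dvd huv 2 p2 hd h2
    have hu3 : ¬ (3 : ℤ) ∣ u := fun hd => not_both_dvd huv 3 p3 hd h3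
    obtain ⟨w, rfl⟩ : (6 : ℤ) ∣ v := by omega
    have huw : IsCoprime u w := huv.of_mul_right_right
    have hco : IsCoprime (1 * u ^ 5) (54 * w ^ 5) := by
      refine coprime_consts huw isCoprime_one_left isCoprime_one_left ?_
      rw [show (54 : ℤ) = 2 * 3 ^ 3 by norm_num]
      exact (co2 hu2).symm.mul_right (co3 hu3).symm.pow_right
    have hou : Odd (1 * u ^ 5) := by rw [one_mul]; exact (oddof hu2).pow
    obtain ⟨a, ha⟩ := param 1 54 144 u w y (by norm_num) huw hco
      (hou.add_even ⟨27 * w ^ 5, by ring⟩) H4 (by rw [h]; ring)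
    obtain ⟨m, n, e1, e2, e3, e4⟩ := pyth _ _ a ha hco hou
    right
    rw [case4 m n u w e3 e4 (by rw [← e1]; ring) e2]; ring
  · have hu2 : ¬ (2 : ℤ) ∣ u := fun hd => not_both_dvd huv 2 p2 hd h2
    obtain ⟨w, rfl⟩ := h2
    have hw3 : ¬ (3 : ℤ) ∣ w := fun hd => h3 (Dvd.dvd.mul_left hd _)
    have huw : IsCoprime u w := huv.of_mul_right_right
    have hco : IsCoprime (9 * u ^ 5) (2 * w ^ 5) := by
      refine coprime_consts huw (by norm_num) ?_ (co2 hu2).symm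
      rw [show (9 : ℤ) = 3 ^ 2 by norm_num]
      exact (co3 hw3).pow_left
    have hou : Odd (9 * u ^ 5) := Odd.mul (by decide) (oddof hu2).pow
    obtain ⟨a, ha⟩ := param 9 2 16 u w y (by norm_num) huw hco
      (hou.add_even ⟨w ^ 5, by ring⟩) H2 (by rw [h]; ring)
    obtain ⟨m, n, e1, e2, e3, e4⟩ := pyth _ _ a ha hco hou
    exact (case2 m n u w e3 e4 e1 e2).elim
  · have hu3 : ¬ (3 : ℤ) ∣ u := fun hd => not_both_dvd huv 3 p3 hd h3
    obtain ⟨w, rfl⟩ := h3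
    have hw2 : ¬ (2 : ℤ) ∣ w := fun hd => h2 (Dvd.dvd.mul_left hd _)
    have huw : IsCoprime u w := huv.of_mul_right_right
    have hco : IsCoprime (16 * u ^ 5) (27 * w ^ 5) := by
      refine coprime_consts huw (by norm_num) ?_ ?_
      · rw [show (16 : ℤ) = 2 ^ 4 by norm_num]
        exact (co2 hw2).pow_left
      · rw [show (27 : ℤ) = 3 ^ 3 by norm_num]
        exact (co3 hu3).symm.pow_right
    have how : Odd (27 * w ^ 5) := Odd.mul (by decide) (oddof hw2).pow
    obtain ⟨a, ha⟩ := param 16 27 9 u w y (by norm_num) huw hco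
      (Even.add_odd ⟨8 * u ^ 5, by ring⟩ how) H3 (by rw [h]; ring)
    obtain ⟨m, n, e1, e2, e3, e4⟩ := pyth _ _ a (by rw [← ha]; ring) hco.symm how
    exact (case3 m n u w e3 e4 e1 e2).elim
  · have hco : IsCoprime (144 * u ^ 5) (1 * v ^ 5) := by
      refine coprime_consts huv isCoprime_one_right ?_ isCoprime_one_right
      rw [show (144 : ℤ) = 2 ^ 4 * 3 ^ 2 by norm_num]
      exact (co2 h2).pow_left.mul_left (co3 h3).pow_left
    have hov : Odd (1 * v ^ 5) := by rw [one_mul]; exact (oddof h2).pow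
    obtain ⟨a, ha⟩ := param 144 1 1 u v y (by norm_num) huv hco
      (Even.add_odd ⟨72 * u ^ 5, by ring⟩ hov) H1 (by rw [h]; ring)
    obtain ⟨m, n, e1, e2, e3, e4⟩ := pyth _ _ a (by rw [← ha]; ring) hco.symm hov
    left
    exact case1 m n u v e3 e4 (by rw [← e1]; ring) e2

end C2

/-- Determination of the rational points on the genus-14 hyperelliptic curve
`C₂ : y² = F₁(u,v)·F₂(u,v)` from Edwards' parametrization, where
`F₁ = 20736 u¹⁰ + v¹⁰` and
`F₂ = 429981696 u²⁰ + 1558683648 u¹⁵v⁵ - 207484416 u¹⁰v¹⁰ - 75168 u⁵v¹⁵ + v²⁰`. -/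
theorem rational_points_C2 (u v y : ℤ) (huv : IsCoprime u v)
    (h : y ^ 2 =
      (20736 * u ^ 10 + v ^ 10) *
        (429981696 * u ^ 20 + 1558683648 * u ^ 15 * v ^ 5
          - 207484416 * u ^ 10 * v ^ 10 - 75168 * u ^ 5 * v ^ 15 + v ^ 20)) :
    u * v = 0 ∧
      ((u = 0 ∧ v = 1 ∧ (y = 1 ∨ y = -1)) ∨
       (u = 0 ∧ v = -1 ∧ (y = 1 ∨ y = -1)) ∨
       (u = 1 ∧ v = 0 ∧ (y = 2985984 ∨ y = -2985984)) ∨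
       (u = -1 ∧ v = 0 ∧ (y = 2985984 ∨ y = -2985984))) := by
  have hy : ∀ c : ℤ, y ^ 2 = c ^ 2 → y = c ∨ y = -c := fun c hc => sq_eq_sq_iff_eq_or_eq_neg.1 hc
  rcases C2.uv_zero u v y huv h with rfl | rfl
  · refine ⟨by ring, ?_⟩
    rcases Int.isUnit_iff.1 (isCoprime_zero_left.1 huv) with rfl | rfl
    · exact Or.inl ⟨rfl, rfl, hy 1 (by rw [h]; norm_num)⟩
    · exact Or.inr (Or.inl ⟨rfl, rfl, hy 1 (by rw [h]; norm_num)⟩)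
  · refine ⟨by ring, ?_⟩
    rcases Int.isUnit_iff.1 (isCoprime_zero_right.1 huv) with rfl | rfl
    · exact Or.inr (Or.inr (Or.inl ⟨rfl, rfl, hy 2985984 (by rw [h]; norm_num)⟩))
    · exact Or.inr (Or.inr (Or.inr ⟨rfl, rfl, hy 2985984 (by rw [h]; norm_num)⟩))
end

section
/- Let F_1(u,v) = 320u^6 + v^6, F_2(u,v) = 102400u^{12} + 32000u^9v^3 + 16440u^6v^6 - 100u^3v^9 + v^{12}, and F_3(u,v) = 102400u^{12} + 896000u^9v^3 - 140160u^6v^6 - 2800u^3v^9 + v^{12}. If u, v are coprime integers and y is an integer with y^2 = F_1(u,v) \cdot F_2(u,v) \cdot F_3(u,v), then u = 0; more precisely (u, v, y) is one of (0, 1, \pm 1), (0, -1, \pm 1). -/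
theorem rep_aux (n : ℕ) : ∀ c k : ℤ, 0 < c → c ≤ n → Odd c → c ∣ k ^ 2 + 3 →
    ∃ p q : ℤ, p ^ 2 + 3 * q ^ 2 = c ∧ c ∣ p + q * k := by
  induction n with
  | zero => intro c k h1 h2; exfalso; push_cast at h2; omega
  | succ n ih =>
    intro c k hc hcn hodd hk
    by_cases h1 : c = 1
    · exact ⟨1, 0, by simp [h1], by simp [h1]⟩
    have hc3 : 3 ≤ c := by obtain ⟨r, hr⟩ := hodd; omega
    -- choose an even representative
    obtain ⟨l, j, hl, hle, hlc⟩ : ∃ l j : ℤ, l = k + c * j ∧ Even l ∧ |l| < c := by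
      have hm := Int.emod_nonneg k (by omega : c ≠ 0)
      have hm2 := Int.emod_lt_of_pos k hc
      have hd := Int.emod_add_mul_ediv k c
      rcases Int.even_or_odd (k % c) with he | ho
      · refine ⟨k % c, -(k / c), by linarith, he, ?_⟩
        rw [abs_lt]; omega
      · refine ⟨k % c - c, -(k / c) - 1, by linarith, ho.sub_odd hodd, ?_⟩
        have : k % c ≠ 0 := by
          intro h0; rw [h0] at ho; simp at ho
        rw [abs_lt]; omega
    have hl3 : c ∣ l ^ 2 + 3 := by
      have : l ^ 2 + 3 = (k ^ 2 + 3) + c * (2 * k * j + c * j ^ 2) := by rw [hl]; ring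
      rw [this]; exact dvd_add hk (Dvd.intro _ rfl)
    obtain ⟨d, hd⟩ := hl3
    have hdpos : 0 < d := by
      by_contra hneg
      nlinarith [sq_nonneg l]
    have hdlt : d < c := by
      by_contra hge
      have h5 : l ^ 2 ≤ (c - 1) ^ 2 := by
        apply sq_le_sq'
        · rw [abs_lt] at hlc; omega
        · rw [abs_lt] at hlc; omega
      nlinarith
    have hdodd : Odd d := by
      have : Odd (c * d) := by
        rw [← hd]
        exact Even.add_odd (by simpa [Int.even_pow] using hle) (by decide)
      exact (Int.odd_mul.mp this).2
    obtain ⟨p, q, hpq, hdv⟩ := ih d (-l) hdpos (by push_cast at hcn; omega) hdodd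
      ⟨c, by linarith [hd, neg_sq l, mul_comm c d]⟩
    obtain ⟨e, he⟩ := hdv
    have hp : p = q * l + d * e := by linarith
    refine ⟨q * c + l * e, -e, ?_, ?_⟩
    · have hd0 : d ≠ 0 := hdpos.ne'
      apply mul_left_cancel₀ (pow_ne_zero 2 hd0)
      have e1 : d * (q * c + l * e) = l * p + 3 * q := by rw [hp]; linear_combination (-q) * hd
      have e2 : d * e = p - l * q := by rw [hp]; ring
      calc d ^ 2 * ((q * c + l * e) ^ 2 + 3 * (-e) ^ 2)
          = (d * (q * c + l * e)) ^ 2 + 3 * (d * e) ^ 2 := by ring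
        _ = (l ^ 2 + 3) * (p ^ 2 + 3 * q ^ 2) := by rw [e1, e2]; ring
        _ = d ^ 2 * c := by rw [hd, hpq]; ring
    · exact ⟨q + e * j, by rw [hl]; ring⟩

theorem rep (c k : ℤ) (hc : 0 < c) (ho : Odd c) (hk : c ∣ k ^ 2 + 3) :
    ∃ p q : ℤ, p ^ 2 + 3 * q ^ 2 = c ∧ c ∣ p + q * k :=
  rep_aux c.toNat c k hc (by omega) ho hk

theorem euler_cube (a b c : ℤ) (hab : IsCoprime a b) (h : a ^ 2 + 3 * b ^ 2 = c ^ 3)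
    (ho : Odd c) :
    ∃ p q : ℤ, a = p * (p ^ 2 - 9 * q ^ 2) ∧ b = 3 * q * (p ^ 2 - q ^ 2) := by
  have hc : 0 < c := by
    by_contra hneg
    have h0 : c ≠ 0 := by rintro rfl; simp at ho
    have : c ^ 3 < 0 := Odd.pow_neg (by decide) (by omega)
    nlinarith [sq_nonneg a, sq_nonneg b]
  have hcop : IsCoprime b (c ^ 3) := by
    rw [← h]
    have : IsCoprime b (a ^ 2) := (hab.symm).pow_right
    have h2 := this.add_mul_left_right (3 * b)
    have h3 : a ^ 2 + 3 * b ^ 2 = a ^ 2 + b * (3 * b) := by ring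
    rw [h3]; exact h2
  obtain ⟨s, t, hst⟩ := hcop
  set k := -(a * s) with hk
  have hk1 : a + b * k = c ^ 3 * (a * t) := by
    rw [hk]; linear_combination (-a) * hst
  have hk2 : c ^ 3 ∣ k ^ 2 + 3 := by
    have h1 : c ^ 3 ∣ b ^ 2 * (k ^ 2 + 3) := by
      refine ⟨(a * t) * (b * k - a) + 1, ?_⟩
      linear_combination (b * k - a) * hk1 + h
    have h2 : IsCoprime (c ^ 3) (b ^ 2) := IsCoprime.pow_right ⟨t, s, by linarith⟩
    exact h2.dvd_of_dvd_mul_left h1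
  have hk3 : c ∣ k ^ 2 + 3 := (dvd_pow_self c (by norm_num)).trans hk2
  obtain ⟨p, q, hpq, e, he⟩ := rep c k hc ho hk3
  obtain ⟨f, hf⟩ := hk2
  have hp : p = c * e - q * k := by linarith
  -- components of the cube
  set P := p * (p ^ 2 - 9 * q ^ 2) with hP
  set Q := 3 * q * (p ^ 2 - q ^ 2) with hQ
  have hPQ : P ^ 2 + 3 * Q ^ 2 = c ^ 3 := by rw [← hpq, hP, hQ]; ring
  have hPk : c ^ 3 ∣ P + Q * k := by
    have : P + Q * k = (p + q * k) ^ 3 - (3 * p * q ^ 2 + q ^ 3 * k) * (k ^ 2 + 3) := by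
      rw [hP, hQ]; ring
    rw [this, he, hf]
    exact dvd_sub ⟨e ^ 3, by ring⟩ ⟨(3 * p * q ^ 2 + q ^ 3 * k) * f, by ring⟩
  obtain ⟨g, hg⟩ := hPk
  have hc3 : (0 : ℤ) < c ^ 3 := by positivity
  obtain ⟨Y, hY⟩ : c ^ 3 ∣ a * Q - b * P := 
    ⟨a * t * Q - b * g, by linear_combination Q * hk1 - b * hg⟩
  obtain ⟨X, hX⟩ : c ^ 3 ∣ a * P + 3 * b * Q := 
    ⟨a * g - Q * k * (a * t) + b * Q * f, by
      linear_combination a * hg - Q * k * hk1 + b * Q * hf⟩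
  have hXY : X ^ 2 + 3 * Y ^ 2 = 1 := by
    have : (c ^ 3) ^ 2 * (X ^ 2 + 3 * Y ^ 2) = (c ^ 3) ^ 2 * 1 := by
      have e1 : (c ^ 3 * X) ^ 2 + 3 * (c ^ 3 * Y) ^ 2 = c ^ 3 * c ^ 3 := by
        rw [← hX, ← hY]
        nth_rewrite 1 [← h]
        rw [← hPQ]; ring
      linarith
    exact mul_left_cancel₀ (by positivity) this
  have hY0 : Y = 0 := by
    by_contra hne
    have : 0 < Y ^ 2 := by positivity
    nlinarith [sq_nonneg X]
  subst hY0
  have hX1 : X = 1 ∨ X = -1 := by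
    have h1 : X ^ 2 = 1 := by linarith
    simpa using h1
  have ha : a = X * P := by
    apply mul_left_cancel₀ hc3.ne'
    linear_combination (-a) * hPQ + P * hX + 3 * Q * hY
  have hb : b = X * Q := by
    apply mul_left_cancel₀ hc3.ne'
    linear_combination (-b) * hPQ + Q * hX - P * hY
  rcases hX1 with rfl | rfl
  · exact ⟨p, q, by linarith, by linarith⟩
  · exact ⟨-p, -q, by rw [ha, hP]; ring, by rw [hb, hQ]; ring⟩

theorem mod_nine (e f c : ℤ) (h : e ^ 3 = 5 * f ^ 3 + 2 * c ^ 3) : 3 ∣ e ∧ 3 ∣ c := by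
  have key : ∀ e f c : ZMod 9, e ^ 3 = 5 * f ^ 3 + 2 * c ^ 3 → 3 * e = 0 ∧ 3 * c = 0 := by
    decide
  have h' : (e : ZMod 9) ^ 3 = 5 * (f : ZMod 9) ^ 3 + 2 * (c : ZMod 9) ^ 3 := by
    exact_mod_cast congrArg (Int.cast : ℤ → ZMod 9) h
  obtain ⟨h1, h2⟩ := key _ _ _ h'
  have g1 : ((3 * e : ℤ) : ZMod 9) = 0 := by push_cast; exact h1
  have g2 : ((3 * c : ℤ) : ZMod 9) = 0 := by push_cast; exact h2
  rw [ZMod.intCast_zmod_eq_zero_iff_dvd] at g1 g2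
  push_cast at g1 g2
  constructor <;> omega

theorem no_common (n : ℤ) (hn : ¬ IsUnit n) {a b : ℤ} (h : IsCoprime a b)
    (ha : n ∣ a) (hb : n ∣ b) : False :=
  hn (h.isUnit_of_dvd' ha hb)

theorem not_unit_two : ¬ IsUnit (2 : ℤ) := by decide
theorem not_unit_three : ¬ IsUnit (3 : ℤ) := by decide
theorem not_unit_five : ¬ IsUnit (5 : ℤ) := by decide

theorem three_cubes {a b c d : ℤ} (hab : IsCoprime a b) (hac : IsCoprime a c)
    (hbc : IsCoprime b c) (h : a * b * c = d ^ 3) :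
    (∃ x, a = x ^ 3) ∧ (∃ x, b = x ^ 3) ∧ ∃ x, c = x ^ 3 := by
  have o : Odd 3 := by decide
  refine ⟨?_, ?_, ?_⟩
  · exact Int.eq_pow_of_mul_eq_pow_odd_left (hab.mul_right hac) o (by rw [← h]; ring)
  · exact Int.eq_pow_of_mul_eq_pow_odd_left (hab.symm.mul_right hbc) o (c := d) (by rw [← h]; ring)
  · exact Int.eq_pow_of_mul_eq_pow_odd_left (hac.symm.mul_right hbc.symm) o (c := d)
      (by rw [← h]; ring)

/-- The form `x² - xy + y²` represents no multiple of 2 or 5 primitively. -/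
theorem norm_two_five (x y : ℤ) (hxy : IsCoprime x y) :
    ¬ (2 : ℤ) ∣ x ^ 2 - x * y + y ^ 2 ∧ ¬ (5 : ℤ) ∣ x ^ 2 - x * y + y ^ 2 := by
  constructor
  · intro h
    have key : ∀ x y : ZMod 2, x ^ 2 - x * y + y ^ 2 = 0 → x = 0 ∧ y = 0 := by decide
    have h' := (ZMod.intCast_zmod_eq_zero_iff_dvd (x ^ 2 - x * y + y ^ 2) 2).mpr (by exact_mod_cast h)
    push_cast at h'
    obtain ⟨h1, h2⟩ := key _ _ h'
    rw [ZMod.intCast_zmod_eq_zero_iff_dvd] at h1 h2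
    exact no_common 2 not_unit_two hxy (by exact_mod_cast h1) (by exact_mod_cast h2)
  · intro h
    have key : ∀ x y : ZMod 5, x ^ 2 - x * y + y ^ 2 = 0 → x = 0 ∧ y = 0 := by decide
    have h' := (ZMod.intCast_zmod_eq_zero_iff_dvd (x ^ 2 - x * y + y ^ 2) 5).mpr (by exact_mod_cast h)
    push_cast at h'
    obtain ⟨h1, h2⟩ := key _ _ h'
    rw [ZMod.intCast_zmod_eq_zero_iff_dvd] at h1 h2
    exact no_common 5 not_unit_five hxy (by exact_mod_cast h1) (by exact_mod_cast h2)

theorem p2 : Prime (2 : ℤ) := Int.prime_two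
theorem p3 : Prime (3 : ℤ) := Int.prime_three
theorem p5 : Prime (5 : ℤ) := by rw [Int.prime_iff_natAbs_prime]; norm_num

/-- Case `3 ∤ z`. -/
theorem ten_case_one (x y z : ℤ) (hxy : IsCoprime x y) (h : x ^ 3 + y ^ 3 = 10 * z ^ 3)
    (hz : ¬ (3 : ℤ) ∣ z) : False := by
  obtain ⟨hN2, hN5⟩ := norm_two_five x y hxy
  set N := x ^ 2 - x * y + y ^ 2 with hN
  have hfac : (x + y) * N = 10 * z ^ 3 := by rw [← h, hN]; ring
  have hs3 : ¬ (3 : ℤ) ∣ x + y := by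
    intro h3
    have h4 : (3 : ℤ) ∣ 10 * z ^ 3 := hfac ▸ (h3.mul_right N)
    rcases p3.dvd_or_dvd h4 with h5 | h5
    · omega
    · exact hz (p3.dvd_of_dvd_pow h5)
  have hcop : IsCoprime (x + y) N := by
    have c1 : IsCoprime (x + y) x := by
      have := hxy.symm.add_mul_left_left 1
      simpa [add_comm] using this
    have c2 : IsCoprime (x + y) y := by
      have := hxy.add_mul_left_left 1
      simpa [add_comm] using this
    have c3 : IsCoprime (x + y) (3 : ℤ) := ((p3.coprime_iff_not_dvd).mpr hs3).symm
    have c4 : IsCoprime (x + y) (-(3 * (x * y))) := (c3.mul_right (c1.mul_right c2)).neg_right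
    have := c4.add_mul_left_right (x + y)
    have e : N = -(3 * (x * y)) + (x + y) * (x + y) := by rw [hN]; ring
    rw [e]; exact this
  have d2 : (2 : ℤ) ∣ x + y :=
    (p2.dvd_or_dvd (a := x + y) (b := N) ⟨5 * z ^ 3, by rw [hfac]; ring⟩).resolve_right hN2
  have d5 : (5 : ℤ) ∣ x + y :=
    (p5.dvd_or_dvd (a := x + y) (b := N) ⟨2 * z ^ 3, by rw [hfac]; ring⟩).resolve_right hN5
  obtain ⟨A, hA⟩ : (10 : ℤ) ∣ x + y := by omega
  have hAN : N * A = z ^ 3 := by rw [hA] at hfac; linarith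
  have hcopA : IsCoprime N A := (hcop.of_isCoprime_of_dvd_left ⟨10, by rw [hA]; ring⟩).symm
  obtain ⟨β, hβ⟩ := Int.eq_pow_of_mul_eq_pow_odd_left hcopA (by decide : Odd 3) hAN
  obtain ⟨E, hE⟩ : (2 : ℤ) ∣ x - y := by omega
  have hx : x = 5 * A + E := by linarith
  have hy : y = 5 * A - E := by linarith
  have hNE : (5 * A) ^ 2 + 3 * E ^ 2 = β ^ 3 := by rw [← hβ, hN, hx, hy]; ring
  have hcE : IsCoprime (5 * A) E := by
    rw [hx, hy] at hxy
    obtain ⟨r, s, hrs⟩ := hxy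
    exact ⟨r + s, r - s, by linear_combination hrs⟩
  have hoβ : Odd β := by
    rw [← Int.not_even_iff_odd]
    intro hev
    apply hN2
    rw [hβ]
    exact dvd_pow hev.two_dvd (by norm_num)
  obtain ⟨p, q, -, hq⟩ := euler_cube _ _ _ hcE hNE hoβ
  have hE3 : (3 : ℤ) ∣ E := ⟨q * (p ^ 2 - q ^ 2), by rw [hq]; ring⟩
  -- work modulo 9
  have key : ∀ x y z : ZMod 9, x ^ 3 + y ^ 3 = 10 * z ^ 3 → 3 * (x - y) = 0 → 3 * z = 0 := by
    decide
  have h' : (x : ZMod 9) ^ 3 + (y : ZMod 9) ^ 3 = 10 * (z : ZMod 9) ^ 3 := by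
    exact_mod_cast congrArg (Int.cast : ℤ → ZMod 9) h
  have h3 : (3 : ZMod 9) * ((x : ZMod 9) - (y : ZMod 9)) = 0 := by
    have : ((3 * (x - y) : ℤ) : ZMod 9) = 0 := by
      rw [ZMod.intCast_zmod_eq_zero_iff_dvd]
      push_cast; omega
    exact_mod_cast this
  have g := key _ _ _ h' h3
  have g1 : ((3 * z : ℤ) : ZMod 9) = 0 := by push_cast; exact g
  rw [ZMod.intCast_zmod_eq_zero_iff_dvd] at g1
  push_cast at g1
  omega

/-- Case `3 ∣ z`: descent step. -/
theorem ten_case_two (x y z : ℤ) (hxy : IsCoprime x y) (h : x ^ 3 + y ^ 3 = 10 * z ^ 3)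
    (hz0 : z ≠ 0) (hz : (3 : ℤ) ∣ z) :
    ∃ x' y' z' : ℤ, IsCoprime x' y' ∧ x' ^ 3 + y' ^ 3 = 10 * z' ^ 3 ∧ z' ≠ 0 ∧
      z'.natAbs < z.natAbs := by
  obtain ⟨hN2, hN5⟩ := norm_two_five x y hxy
  obtain ⟨w, hw⟩ := hz
  have hs3 : (3 : ℤ) ∣ x + y := by
    have : (3 : ℤ) ∣ (x + y) ^ 3 :=
      ⟨90 * w ^ 3 + x * y * (x + y), by rw [hw] at h; linear_combination h⟩
    exact p3.dvd_of_dvd_pow this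
  obtain ⟨A, hA⟩ := hs3
  have hyA : y = 3 * A - x := by linarith
  have hcAx : IsCoprime A x := by
    rw [hyA] at hxy
    obtain ⟨r, s, hrs⟩ := hxy
    exact ⟨3 * s, r - s, by linear_combination hrs⟩
  set M := x ^ 2 + A * (3 * A - 3 * x) with hM
  have hNM : x ^ 2 - x * y + y ^ 2 = 3 * M := by rw [hM, hyA]; ring
  rw [hNM] at hN2 hN5
  have hM2 : ¬ (2 : ℤ) ∣ M := fun hh => hN2 (hh.mul_left 3)
  have hM5 : ¬ (5 : ℤ) ∣ M := fun hh => hN5 (hh.mul_left 3)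
  have hM3 : ¬ (3 : ℤ) ∣ M := by
    intro hh
    have : (3 : ℤ) ∣ x ^ 2 := by
      have e : x ^ 2 = M - 3 * (A * (A - x)) := by rw [hM]; ring
      rw [e]; exact dvd_sub hh (Dvd.intro _ rfl)
    have h3x := p3.dvd_of_dvd_pow this
    exact no_common 3 not_unit_three hxy h3x (by omega)
  have hcAM : IsCoprime A M := (hcAx.pow_right (n := 2)).add_mul_left_right _
  have hAM : A * M = 30 * w ^ 3 := by
    have : (x + y) * (x ^ 2 - x * y + y ^ 2) = 10 * z ^ 3 := by rw [← h]; ring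
    rw [hNM, hA, hw] at this
    linarith
  have d2 : (2 : ℤ) ∣ A :=
    (p2.dvd_or_dvd (a := A) (b := M) ⟨15 * w ^ 3, by rw [hAM]; ring⟩).resolve_right hM2
  have d3 : (3 : ℤ) ∣ A :=
    (p3.dvd_or_dvd (a := A) (b := M) ⟨10 * w ^ 3, by rw [hAM]; ring⟩).resolve_right hM3
  have d5 : (5 : ℤ) ∣ A :=
    (p5.dvd_or_dvd (a := A) (b := M) ⟨6 * w ^ 3, by rw [hAM]; ring⟩).resolve_right hM5
  obtain ⟨B, hB⟩ : (30 : ℤ) ∣ A := by omega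
  have hBM : B * M = w ^ 3 := by rw [hB] at hAM; linarith
  have hcBM : IsCoprime B M := hcAM.of_isCoprime_of_dvd_left ⟨30, by rw [hB]; ring⟩
  obtain ⟨⟨α, hα⟩, ⟨β, hβ⟩⟩ := Int.eq_pow_of_mul_eq_pow_odd hcBM (by decide : Odd 3) hBM
  obtain ⟨E, hE⟩ : (2 : ℤ) ∣ x - y := by omega
  have hx : x = 45 * α ^ 3 + E := by rw [← hα]; linarith
  have hy : y = 45 * α ^ 3 - E := by rw [← hα]; linarith
  have hNE : E ^ 2 + 3 * (15 * α ^ 3) ^ 2 = β ^ 3 := by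
    rw [← hβ]
    have : 3 * (E ^ 2 + 3 * (15 * α ^ 3) ^ 2) = 3 * M := by rw [← hNM, hx, hy]; ring
    linarith
  have hcE : IsCoprime E (15 * α ^ 3) := by
    rw [hx, hy] at hxy
    obtain ⟨r, s, hrs⟩ := hxy
    exact ⟨r - s, 3 * (r + s), by linear_combination hrs⟩
  have hoβ : Odd β := by
    rw [← Int.not_even_iff_odd]
    intro hev
    apply hM2
    rw [hβ]
    exact dvd_pow hev.two_dvd (by norm_num)
  obtain ⟨p, q, hp, hq⟩ := euler_cube _ _ _ hcE hNE hoβ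
  have hprod : 5 * α ^ 3 = q * (p - q) * (p + q) := by linarith
  have hcpq : IsCoprime p q :=
    (hcE.of_isCoprime_of_dvd_left ⟨_, hp⟩).of_isCoprime_of_dvd_right
      ⟨3 * (p ^ 2 - q ^ 2), by rw [hq]; ring⟩
  have hpar : ¬ (2 : ℤ) ∣ p - q := by
    intro h2
    obtain ⟨r, hr⟩ := h2
    have hpr : p = q + 2 * r := by linarith
    refine no_common 2 not_unit_two hcE ?_ ?_
    · rcases Int.even_or_odd' q with ⟨m, hm | hm⟩
      · exact ⟨(m + r) * (p ^ 2 - 9 * q ^ 2), by rw [hp]; nth_rewrite 1 [hpr]; rw [hm]; ring⟩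
      · rw [hp]
        refine Dvd.dvd.mul_left ?_ _
        exact ⟨-4 * q ^ 2 + 2 * q * r + 2 * r ^ 2, by rw [hpr]; ring⟩
    · rw [hq]
      exact ⟨3 * q * (r * (p + q)), by rw [show p ^ 2 - q ^ 2 = (p - q) * (p + q) by ring, hr]; ring⟩
  have c1 : IsCoprime q (p - q) := by
    have := (hcpq.symm).add_mul_left_right (-1)
    have e : p - q = p + q * -1 := by ring
    rw [e]; exact this
  have c2 : IsCoprime q (p + q) := by
    have := (hcpq.symm).add_mul_left_right 1
    have e : p + q = p + q * 1 := by ring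
    rw [e]; exact this
  have c3 : IsCoprime (p - q) (p + q) := by
    have e2 : IsCoprime (p - q) 2 := ((p2.coprime_iff_not_dvd).mpr hpar).symm
    have := (e2.mul_right c1.symm).add_mul_left_right 1
    have e : p + q = 2 * q + (p - q) * 1 := by ring
    rw [e]; exact this
  have hα0 : α ≠ 0 := by
    rintro rfl
    rw [hα] at hBM
    apply hz0
    rw [hw]
    have : w ^ 3 = 0 := by rw [← hBM]; ring
    have := pow_eq_zero_iff (three_ne_zero) |>.mp this
    rw [this]; ring
  have h5 : (5 : ℤ) ∣ q * (p - q) * (p + q) := ⟨α ^ 3, hprod.symm⟩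
  rcases p5.dvd_or_dvd h5 with h5 | ⟨r, hr⟩
  · rcases p5.dvd_or_dvd h5 with ⟨r, hr⟩ | ⟨r, hr⟩
    · have hdr : r ∣ q := ⟨5, by linarith⟩
      have hc : r * (p - q) * (p + q) = α ^ 3 := by
        nth_rewrite 1 [hr] at hprod; linarith
      obtain ⟨⟨c, hc'⟩, ⟨f, hf⟩, ⟨e, he⟩⟩ := three_cubes (c1.of_isCoprime_of_dvd_left hdr)
        (c2.of_isCoprime_of_dvd_left hdr) c3 hc
      have hcα : c ∣ α := by
        have : c ^ 3 ∣ α ^ 3 := ⟨(p - q) * (p + q), by rw [← hc, hc']; ring⟩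
        exact (Int.pow_dvd_pow_iff (by norm_num)).mp this
      have hαw : α ∣ w := by
        have : α ^ 3 ∣ w ^ 3 := ⟨M, by rw [← hBM, hα]⟩
        exact (Int.pow_dvd_pow_iff (by norm_num)).mp this
      have hcw : c ∣ w := hcα.trans hαw
      have hw0 : w ≠ 0 := by rintro rfl; simp at hw; exact hz0 hw
      refine ⟨e, -f, c, ?_, ?_, ?_, ?_⟩
      · rw [hf, he] at c3
        have := (IsCoprime.pow_iff (by norm_num : 0 < 3) (by norm_num : 0 < 3)).mp c3
        exact this.symm.neg_right
      · rw [← hc']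
        have : e ^ 3 + (-f) ^ 3 = e ^ 3 - f ^ 3 := by ring
        rw [this, ← he, ← hf]; linarith
      · rintro rfl; exact hα0 (zero_dvd_iff.mp hcα)
      · have h1 := Int.natAbs_le_of_dvd_ne_zero hcw hw0
        omega
    · exfalso
      have hdr : r ∣ p - q := ⟨5, by linarith⟩
      have hc : q * r * (p + q) = α ^ 3 := by
        nth_rewrite 1 [hr] at hprod; linarith
      obtain ⟨⟨c, hc'⟩, ⟨f, hf⟩, ⟨e, he⟩⟩ := three_cubes (c1.of_isCoprime_of_dvd_right hdr)
        c2 (c3.of_isCoprime_of_dvd_left hdr) hc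
      obtain ⟨g1, g2⟩ := mod_nine e f c (by rw [← hf, ← he, ← hc']; linarith)
      exact no_common 3 not_unit_three c2 (hc' ▸ dvd_pow g2 (by norm_num))
        (he ▸ dvd_pow g1 (by norm_num))
  · exfalso
    have hdr : r ∣ p + q := ⟨5, by linarith⟩
    have hc : q * (p - q) * r = α ^ 3 := by
      nth_rewrite 1 [hr] at hprod; linarith
    obtain ⟨⟨c, hc'⟩, ⟨f, hf⟩, ⟨e, he⟩⟩ := three_cubes c1 (c2.of_isCoprime_of_dvd_right hdr)
      (c3.of_isCoprime_of_dvd_right hdr) hc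
    obtain ⟨g1, g2⟩ := mod_nine f e (-c) (by
      rw [show (-c) ^ 3 = -(c ^ 3) by ring, ← hf, ← he, ← hc']; linarith)
    exact no_common 3 not_unit_three c1 (hc' ▸ dvd_pow ((dvd_neg).mp g2) (by norm_num))
      (hf ▸ dvd_pow g1 (by norm_num))

theorem ten_aux (n : ℕ) : ∀ x y z : ℤ, IsCoprime x y → x ^ 3 + y ^ 3 = 10 * z ^ 3 →
    z.natAbs ≤ n → z = 0 := by
  induction n with
  | zero => intro x y z _ _ h; omega
  | succ n ih =>
    intro x y z hxy h hn
    by_contra hz0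
    by_cases hz : (3 : ℤ) ∣ z
    · obtain ⟨x', y', z', h1, h2, h3, h4⟩ := ten_case_two x y z hxy h hz0 hz
      exact h3 (ih x' y' z' h1 h2 (by omega))
    · exact ten_case_one x y z hxy h hz

theorem ten (x y z : ℤ) (hxy : IsCoprime x y) (h : x ^ 3 + y ^ 3 = 10 * z ^ 3) : z = 0 :=
  ten_aux z.natAbs x y z hxy h le_rfl

/-- `320u⁶ + v⁶` is not a square for `u ≠ 0`, `v` prime to `10u`. -/
theorem F1_not_square (u v w : ℤ) (huv : IsCoprime u v) (hv2 : ¬ (2 : ℤ) ∣ v)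
    (hv5 : ¬ (5 : ℤ) ∣ v) (h : 320 * u ^ 6 + v ^ 6 = w ^ 2) : u = 0 := by
  by_contra hu0
  have hvo : Odd v := by rw [← Int.not_even_iff_odd]; exact fun hh => hv2 hh.two_dvd
  have hwo : Odd w := by
    have h1 : Odd (w ^ 2) := by
      rw [← h]
      exact Even.add_odd ⟨160 * u ^ 6, by ring⟩ hvo.pow
    rwa [Int.odd_pow' (by norm_num)] at h1
  obtain ⟨m, hm⟩ : (2 : ℤ) ∣ w - v ^ 3 := (hwo.sub_odd hvo.pow).two_dvd
  have hmn : m * (m + v ^ 3) = 80 * u ^ 6 := by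
    have hw : w = v ^ 3 + 2 * m := by linarith
    rw [hw] at h; linarith
  have k2 : IsCoprime v 2 := ((p2.coprime_iff_not_dvd).mpr hv2).symm
  have k5 : IsCoprime v 5 := ((p5.coprime_iff_not_dvd).mpr hv5).symm
  have hv80 : IsCoprime v (m * (m + v ^ 3)) := by
    have e : m * (m + v ^ 3) = 2 ^ 4 * 5 * u ^ 6 := by rw [hmn]; ring
    rw [e]
    exact (k2.pow_right.mul_right k5).mul_right huv.symm.pow_right
  have hvm : IsCoprime v m := hv80.of_mul_right_left
  have hvn : IsCoprime v (m + v ^ 3) := hv80.of_mul_right_right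
  have hmnc : IsCoprime m (m + v ^ 3) := by
    have := (hvm.symm.pow_right (n := 3)).add_mul_left_right 1
    have e : m + v ^ 3 = v ^ 3 + m * 1 := by ring
    rw [e]; exact this
  generalize hn : m + v ^ 3 = n at *
  have hv : v ^ 3 = n - m := by linarith
  have o3 : Odd 3 := by decide
  have h16 : (16 : ℤ) ∣ m ∨ (16 : ℤ) ∣ n := by
    by_cases h2 : (2 : ℤ) ∣ m
    · left
      have hn2 : ¬ (2 : ℤ) ∣ n := fun hh => no_common 2 not_unit_two hmnc h2 hh
      have c : IsCoprime ((2 : ℤ) ^ 4) n := ((p2.coprime_iff_not_dvd).mpr hn2).pow_left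
      have : (2 : ℤ) ^ 4 ∣ m * n := ⟨5 * u ^ 6, by rw [hmn]; ring⟩
      have := c.dvd_of_dvd_mul_right this
      norm_num at this; exact this
    · right
      have c : IsCoprime ((2 : ℤ) ^ 4) m := ((p2.coprime_iff_not_dvd).mpr h2).pow_left
      have : (2 : ℤ) ^ 4 ∣ m * n := ⟨5 * u ^ 6, by rw [hmn]; ring⟩
      have := c.dvd_of_dvd_mul_left this
      norm_num at this; exact this
  have h5 : (5 : ℤ) ∣ m ∨ (5 : ℤ) ∣ n :=
    p5.dvd_or_dvd ⟨16 * u ^ 6, by rw [hmn]; ring⟩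
  have fin : ∀ s t : ℤ, s ^ 3 * t ^ 3 = (u ^ 2) ^ 3 → s ≠ 0 := by
    rintro s t hst rfl
    have : (u ^ 2) ^ 3 = 0 := by rw [← hst]; ring
    exact hu0 (by simpa using this)
  rcases h16 with h16 | h16 <;> rcases h5 with h5 | h5
  · obtain ⟨r, hr⟩ : (80 : ℤ) ∣ m := by omega
    have hrn : r * n = (u ^ 2) ^ 3 := by rw [hr] at hmn; linarith
    have hc : IsCoprime r n := hmnc.of_isCoprime_of_dvd_left ⟨80, by linarith⟩
    obtain ⟨⟨s, hs⟩, ⟨t, ht⟩⟩ := Int.eq_pow_of_mul_eq_pow_odd hc o3 hrn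
    have hs0 := fin s t (by rw [← hs, ← ht, hrn])
    have hct : IsCoprime t (-v) := by
      rw [ht] at hvn
      exact ((IsCoprime.pow_right_iff (by norm_num)).mp hvn).symm.neg_right
    have := ten t (-v) (2 * s) hct (by
      rw [show (-v) ^ 3 = - v ^ 3 by ring, hv, ← ht, hr, hs]; ring)
    omega
  · obtain ⟨r, hr⟩ := h16
    obtain ⟨r', hr'⟩ := h5
    have hrn : r * r' = (u ^ 2) ^ 3 := by rw [hr, hr'] at hmn; linarith
    have hc : IsCoprime r r' := (hmnc.of_isCoprime_of_dvd_left
      ⟨16, by linarith⟩).of_isCoprime_of_dvd_right ⟨5, by linarith⟩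
    obtain ⟨⟨s, hs⟩, ⟨t, ht⟩⟩ := Int.eq_pow_of_mul_eq_pow_odd hc o3 hrn
    obtain ⟨g1, g2⟩ := mod_nine v t (-2 * s) (by rw [hv, hr, hr', hs, ht]; ring)
    have g3 : (3 : ℤ) ∣ s := by omega
    exact no_common 3 not_unit_three hvm g1
      (hr ▸ (hs ▸ (dvd_pow g3 (by norm_num : 3 ≠ 0))).mul_left 16)
  · obtain ⟨r, hr⟩ := h16
    obtain ⟨r', hr'⟩ := h5
    have hrn : r' * r = (u ^ 2) ^ 3 := by rw [hr, hr'] at hmn; linarith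
    have hc : IsCoprime r' r := (hmnc.of_isCoprime_of_dvd_left
      ⟨5, by linarith⟩).of_isCoprime_of_dvd_right ⟨16, by linarith⟩
    obtain ⟨⟨s, hs⟩, ⟨t, ht⟩⟩ := Int.eq_pow_of_mul_eq_pow_odd hc o3 hrn
    obtain ⟨g1, g2⟩ := mod_nine v (-s) (2 * t) (by rw [hv, hr, hr', hs, ht]; ring)
    have g3 : (3 : ℤ) ∣ t := by omega
    exact no_common 3 not_unit_three hvn g1
      (hr ▸ (ht ▸ (dvd_pow g3 (by norm_num : 3 ≠ 0))).mul_left 16)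
  · obtain ⟨r, hr⟩ : (80 : ℤ) ∣ n := by omega
    have hrn : r * m = (u ^ 2) ^ 3 := by rw [hr] at hmn; linarith
    have hc : IsCoprime r m := hmnc.symm.of_isCoprime_of_dvd_left ⟨80, by linarith⟩
    obtain ⟨⟨s, hs⟩, ⟨t, ht⟩⟩ := Int.eq_pow_of_mul_eq_pow_odd hc o3 hrn
    have hs0 := fin s t (by rw [← hs, ← ht, hrn])
    have hct : IsCoprime t v := by
      rw [ht] at hvm
      exact ((IsCoprime.pow_right_iff (by norm_num)).mp hvm).symm
    have := ten t v (2 * s) hct (by rw [hv, ← ht, hr, hs]; ring)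
    omega

theorem odd_val (p : ℤ) (hp : Prime p) (k : ℕ) : ∀ y K : ℤ, y ^ 2 = p ^ (2 * k + 1) * K → p ∣ K := by
  induction k with
  | zero =>
    intro y K h
    have h1 : p ∣ y := hp.dvd_of_dvd_pow (n := 2) ⟨K, by rw [h]; ring⟩
    obtain ⟨z, hz⟩ := h1
    refine ⟨z ^ 2, mul_left_cancel₀ hp.ne_zero ?_⟩
    rw [hz] at h
    linear_combination -h
  | succ k ih =>
    intro y K h
    have h1 : p ∣ y := hp.dvd_of_dvd_pow (n := 2) ⟨p ^ (2 * k + 2) * K, by rw [h]; ring⟩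
    obtain ⟨z, hz⟩ := h1
    refine ih z K (mul_left_cancel₀ (pow_ne_zero 2 hp.ne_zero) ?_)
    rw [hz] at h
    linear_combination h

theorem prime_not_dvd_aux {p c x r : ℤ} {n : ℕ} (hp : Prime p) (hc : ¬ p ∣ c)
    (h : p ∣ c * x ^ n + p * r) : p ∣ x := by
  have h1 : p ∣ c * x ^ n := (dvd_add_left (Dvd.intro _ rfl)).mp h
  rcases hp.dvd_or_dvd h1 with h2 | h2
  · exact absurd h2 hc
  · exact hp.dvd_of_dvd_pow h2

theorem five_not_dvd (u v y : ℤ) (huv : IsCoprime u v)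
    (h : y ^ 2 =
      (320 * u ^ 6 + v ^ 6) *
        (102400 * u ^ 12 + 32000 * u ^ 9 * v ^ 3 + 16440 * u ^ 6 * v ^ 6
          - 100 * u ^ 3 * v ^ 9 + v ^ 12) *
        (102400 * u ^ 12 + 896000 * u ^ 9 * v ^ 3 - 140160 * u ^ 6 * v ^ 6
          - 2800 * u ^ 3 * v ^ 9 + v ^ 12)) : ¬ (5 : ℤ) ∣ v := by
  rintro ⟨w, rfl⟩
  have key := odd_val 5 p5 2 y
    ((64 * u ^ 6 + 5 * (625 * w ^ 6)) *
      (4096 * u ^ 12 + 5 * (32000 * u ^ 9 * w ^ 3 + 2055000 * u ^ 6 * w ^ 6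
        - 1562500 * u ^ 3 * w ^ 9 + 1953125 * w ^ 12)) *
      (4096 * u ^ 12 + 5 * (896000 * u ^ 9 * w ^ 3 - 17520000 * u ^ 6 * w ^ 6
        - 43750000 * u ^ 3 * w ^ 9 + 1953125 * w ^ 12))) (by rw [h]; ring)
  have hu : (5 : ℤ) ∣ u := by
    rcases p5.dvd_or_dvd key with key | key
    · rcases p5.dvd_or_dvd key with key | key
      · exact prime_not_dvd_aux p5 (by norm_num) key
      · exact prime_not_dvd_aux p5 (by norm_num) key
    · exact prime_not_dvd_aux p5 (by norm_num) key
  exact no_common 5 not_unit_five huv hu (Dvd.intro _ rfl)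

theorem three_dvd (u v y : ℤ)
    (h : y ^ 2 =
      (320 * u ^ 6 + v ^ 6) *
        (102400 * u ^ 12 + 32000 * u ^ 9 * v ^ 3 + 16440 * u ^ 6 * v ^ 6
          - 100 * u ^ 3 * v ^ 9 + v ^ 12) *
        (102400 * u ^ 12 + 896000 * u ^ 9 * v ^ 3 - 140160 * u ^ 6 * v ^ 6
          - 2800 * u ^ 3 * v ^ 9 + v ^ 12)) : (3 : ℤ) ∣ u := by
  have cube : ∀ a b : ZMod 9, 3 * a = 0 ∨ 3 * b = 0 ∨ b ^ 3 - a ^ 3 = 0 ∨ b ^ 3 + a ^ 3 = 0 := by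
    decide
  have h3 : (3 : ℤ) ∣ u ∨ (3 : ℤ) ∣ v ∨ (9 : ℤ) ∣ v ^ 3 - u ^ 3 ∨ (9 : ℤ) ∣ v ^ 3 + u ^ 3 := by
    rcases cube (u : ZMod 9) (v : ZMod 9) with h | h | h | h
    · have g : ((3 * u : ℤ) : ZMod 9) = 0 := by push_cast; exact h
      rw [ZMod.intCast_zmod_eq_zero_iff_dvd] at g
      push_cast at g; omega
    · have g : ((3 * v : ℤ) : ZMod 9) = 0 := by push_cast; exact h
      rw [ZMod.intCast_zmod_eq_zero_iff_dvd] at g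
      push_cast at g; omega
    · have g : ((v ^ 3 - u ^ 3 : ℤ) : ZMod 9) = 0 := by push_cast; exact h
      rw [ZMod.intCast_zmod_eq_zero_iff_dvd] at g
      right; right; left; exact_mod_cast g
    · have g : ((v ^ 3 + u ^ 3 : ℤ) : ZMod 9) = 0 := by push_cast; exact h
      rw [ZMod.intCast_zmod_eq_zero_iff_dvd] at g
      right; right; right; exact_mod_cast g
  generalize ha : u ^ 3 = a at *
  generalize hb : v ^ 3 = b at *
  have h' : y ^ 2 = (320 * a ^ 2 + b ^ 2) *
        (102400 * a ^ 4 + 32000 * a ^ 3 * b + 16440 * a ^ 2 * b ^ 2 - 100 * a * b ^ 3 + b ^ 4) *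
        (102400 * a ^ 4 + 896000 * a ^ 3 * b - 140160 * a ^ 2 * b ^ 2
          - 2800 * a * b ^ 3 + b ^ 4) := by
    rw [h, ← ha, ← hb]; ring
  suffices hs : (3 : ℤ) ∣ u ∨ (3 : ℤ) ∣ a by
    rcases hs with hs | hs
    · exact hs
    · rw [← ha] at hs; exact p3.dvd_of_dvd_pow hs
  rcases h3 with h3 | h3 | ⟨m, hm⟩ | ⟨m, hm⟩
  · exact Or.inl h3
  · right
    obtain ⟨w, hw⟩ : (3 : ℤ) ∣ b := by rw [← hb]; exact dvd_pow h3 (by norm_num)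
    have key : ∀ y a : ZMod 3, y ^ 2 = 2 * a ^ 10 → a = 0 := by decide
    have hc := congrArg (Int.cast : ℤ → ZMod 3) h'
    have hb0 : (b : ZMod 3) = 0 := by
      rw [ZMod.intCast_zmod_eq_zero_iff_dvd]; exact ⟨w, by exact_mod_cast hw⟩
    push_cast at hc
    rw [hb0] at hc
    have e1 : (320 : ZMod 3) = 2 := by decide
    have e2 : (102400 : ZMod 3) = 1 := by decide
    rw [e1, e2] at hc
    have := key (y : ZMod 3) (a : ZMod 3) (by rw [hc]; ring)
    rw [ZMod.intCast_zmod_eq_zero_iff_dvd] at this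
    exact_mod_cast this
  · right
    have hbm : b = a + 9 * m := by linarith
    have key := odd_val 3 p3 4 y
      ((107 * a ^ 2 + 3 * (2 * a * m + 9 * m ^ 2)) *
       (1861 * a ^ 4 + 3 * (2392 * a ^ 3 * m + 5382 * a ^ 2 * m ^ 2 - 288 * a * m ^ 3
          + 27 * m ^ 4)) *
       (10561 * a ^ 4 + 3 * (22492 * a ^ 3 * m - 49518 * a ^ 2 * m ^ 2 - 8388 * a * m ^ 3
          + 27 * m ^ 4))) (by rw [h', hbm]; ring)
    rcases p3.dvd_or_dvd key with key | key
    · rcases p3.dvd_or_dvd key with key | key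
      · exact prime_not_dvd_aux p3 (by norm_num) key
      · exact prime_not_dvd_aux p3 (by norm_num) key
    · exact prime_not_dvd_aux p3 (by norm_num) key
  · right
    have ham : b = - a + 9 * m := by linarith
    have key := odd_val 3 p3 0 y
      ((107 * a ^ 2 + 3 * (-2 * a * m + 9 * m ^ 2)) *
        (102400 * a ^ 4 + 32000 * a ^ 3 * b + 16440 * a ^ 2 * b ^ 2 - 100 * a * b ^ 3 + b ^ 4) *
        (102400 * a ^ 4 + 896000 * a ^ 3 * b - 140160 * a ^ 2 * b ^ 2
          - 2800 * a * b ^ 3 + b ^ 4)) (by rw [h', ham]; ring)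
    rcases p3.dvd_or_dvd key with key | key
    · rcases p3.dvd_or_dvd key with key | key
      · exact prime_not_dvd_aux p3 (by norm_num) key
      · have e : 102400 * a ^ 4 + 32000 * a ^ 3 * b + 16440 * a ^ 2 * b ^ 2 - 100 * a * b ^ 3 + b ^ 4
            = (86941) * a ^ 4 + 3 * ((-3552) * a ^ 3 * m + (452142) * a ^ 2 * m ^ 2 + (-25272) * a * m ^ 3 + (2187) * m ^ 4) := by
          rw [ham]; ring
        rw [e] at key
        exact prime_not_dvd_aux p3 (by norm_num) key
    · have e : 102400 * a ^ 4 + 896000 * a ^ 3 * b - 140160 * a ^ 2 * b ^ 2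
          - 2800 * a * b ^ 3 + b ^ 4
          = (-930959) * a ^ 4 + 3 * ((3503748) * a ^ 3 * m + (-3557358) * a ^ 2 * m ^ 2 + (-681372) * a * m ^ 3 + (2187) * m ^ 4) := by
        rw [ham]; ring
      rw [e] at key
      exact prime_not_dvd_aux p3 (by norm_num) key

theorem common_prime (u v p : ℤ) (hp : Prime p) (huv : IsCoprime u v) (hu3 : (3 : ℤ) ∣ u)
    (hv5 : ¬ (5 : ℤ) ∣ v) (h1 : p ∣ 320 * u ^ 6 + v ^ 6)
    (h2 : p ∣ (102400 * u ^ 12 + 32000 * u ^ 9 * v ^ 3 + 16440 * u ^ 6 * v ^ 6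
          - 100 * u ^ 3 * v ^ 9 + v ^ 12) *
        (102400 * u ^ 12 + 896000 * u ^ 9 * v ^ 3 - 140160 * u ^ 6 * v ^ 6
          - 2800 * u ^ 3 * v ^ 9 + v ^ 12)) : p ∣ 2 := by
  have hpu : ¬ p ∣ u := by
    intro hh
    have h3 : p ∣ v ^ 6 := by
      have e : v ^ 6 = (320 * u ^ 6 + v ^ 6) - u * (320 * u ^ 5) := by ring
      rw [e]; exact dvd_sub h1 (hh.mul_right _)
    exact no_common p hp.not_isUnit huv hh (hp.dvd_of_dvd_pow h3)
  have hpun : ∀ n, ¬ p ∣ u ^ n := fun n hh => hpu (hp.dvd_of_dvd_pow hh)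
  have hp3 : ¬ p ∣ 3 := fun hh => hpu (hh.trans hu3)
  have hp5 : ¬ p ∣ 5 := by
    intro hh
    have h3 : p ∣ v ^ 6 := by
      have e : v ^ 6 = (320 * u ^ 6 + v ^ 6) - 5 * (64 * u ^ 6) := by ring
      rw [e]; exact dvd_sub h1 (hh.mul_right _)
    have has := (hp.dvd_prime_iff_associated p5).mp hh
    exact hv5 (has.symm.dvd.trans (hp.dvd_of_dvd_pow h3))
  have small : ∀ i j k : ℕ, p ∣ 2 ^ i * 3 ^ j * 5 ^ k → p ∣ 2 := by
    intro i j k hh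
    rcases hp.dvd_or_dvd hh with hh | hh
    · rcases hp.dvd_or_dvd hh with hh | hh
      · exact hp.dvd_of_dvd_pow hh
      · exact absurd (hp.dvd_of_dvd_pow hh) hp3
    · exact absurd (hp.dvd_of_dvd_pow hh) hp5
  rcases hp.dvd_or_dvd h2 with h2 | h2
  · have h3 : p ∣ (2 ^ 9 * 3 ^ 0 * 5 ^ 3) * u ^ 9 * (v ^ 3 - 79 * u ^ 3) := by
      have := dvd_sub h2 (h1.mul_right (v ^ 6 - 100 * u ^ 3 * v ^ 3 + 16120 * u ^ 6))
      ring_nf at this ⊢; exact this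
    rcases hp.dvd_or_dvd h3 with h3 | h3
    · rcases hp.dvd_or_dvd h3 with h3 | h3
      · exact small _ _ _ h3
      · exact absurd h3 (hpun 9)
    · have h4 : p ∣ (2 ^ 0 * 3 ^ 8 * 5 ^ 0) * u ^ 6 := by
        have := dvd_sub h1 (h3.mul_right (v ^ 3 + 79 * u ^ 3))
        ring_nf at this ⊢; exact this
      rcases hp.dvd_or_dvd h4 with h4 | h4
      · exact small _ _ _ h4
      · exact absurd h4 (hpun 6)
  · have h3 : p ∣ (2 ^ 11 * 3 ^ 0 * 5 ^ 3) * u ^ 9 * (7 * v ^ 3 + 176 * u ^ 3) := by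
      have := dvd_sub h2 (h1.mul_right (v ^ 6 - 2800 * u ^ 3 * v ^ 3 - 140480 * u ^ 6))
      ring_nf at this ⊢; exact this
    rcases hp.dvd_or_dvd h3 with h3 | h3
    · rcases hp.dvd_or_dvd h3 with h3 | h3
      · exact small _ _ _ h3
      · exact absurd h3 (hpun 9)
    · have h4 : p ∣ (2 ^ 6 * 3 ^ 6 * 5 ^ 0) * u ^ 6 := by
        have := dvd_sub (h1.mul_left 49) (h3.mul_right (7 * v ^ 3 - 176 * u ^ 3))
        ring_nf at this ⊢; exact this
      rcases hp.dvd_or_dvd h4 with h4 | h4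
      · exact small _ _ _ h4
      · exact absurd h4 (hpun 6)

/-- An odd positive divisor `T` of `F₁` whose cofactor is a power of two is a square. -/
theorem part_square (T G y : ℤ) (k : ℕ) (hT : 0 < T) (hodd : ¬ (2 : ℤ) ∣ T)
    (hc : ∀ p : ℤ, Prime p → p ∣ T → p ∣ G → p ∣ 2) (h : y ^ 2 = T * (2 ^ k * G)) :
    ∃ w, T = w ^ 2 := by
  have hcop : IsCoprime T (2 ^ k * G) := by
    apply isCoprime_of_prime_dvd
    · rintro ⟨h0, -⟩; omega
    · intro p hp h1 h2
      have hp2 : p ∣ 2 := by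
        rcases hp.dvd_or_dvd h2 with h2 | h2
        · exact hp.dvd_of_dvd_pow h2
        · exact hc p hp h1 h2
      have has := (hp.dvd_prime_iff_associated p2).mp hp2
      exact hodd (has.symm.dvd.trans h1)
  obtain ⟨w, hw | hw⟩ := Int.sq_of_isCoprime hcop h.symm
  · exact ⟨w, hw⟩
  · nlinarith [sq_nonneg w]

theorem rational_points_C3 (u v y : ℤ) (huv : IsCoprime u v)
    (h : y ^ 2 =
      (320 * u ^ 6 + v ^ 6) *
        (102400 * u ^ 12 + 32000 * u ^ 9 * v ^ 3 + 16440 * u ^ 6 * v ^ 6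
          - 100 * u ^ 3 * v ^ 9 + v ^ 12) *
        (102400 * u ^ 12 + 896000 * u ^ 9 * v ^ 3 - 140160 * u ^ 6 * v ^ 6
          - 2800 * u ^ 3 * v ^ 9 + v ^ 12)) :
    u = 0 ∧
      ((u = 0 ∧ v = 1 ∧ (y = 1 ∨ y = -1)) ∨
       (u = 0 ∧ v = -1 ∧ (y = 1 ∨ y = -1))) := by
  have hu3 := three_dvd u v y h
  have hv5 := five_not_dvd u v y huv h
  have hcp := fun p hp => common_prime u v p hp huv hu3 hv5
  have hpos : 0 < 320 * u ^ 6 + v ^ 6 := by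
    by_cases hv0 : v = 0
    · exact absurd (hv0 ▸ dvd_zero 5) hv5
    · positivity
  rw [mul_assoc] at h
  have hu : u = 0 := by
    generalize hG : (102400 * u ^ 12 + 32000 * u ^ 9 * v ^ 3 + 16440 * u ^ 6 * v ^ 6
          - 100 * u ^ 3 * v ^ 9 + v ^ 12) *
        (102400 * u ^ 12 + 896000 * u ^ 9 * v ^ 3 - 140160 * u ^ 6 * v ^ 6
          - 2800 * u ^ 3 * v ^ 9 + v ^ 12) = G at *
    by_cases hv2 : (2 : ℤ) ∣ v
    · exfalso
      have hu2 : ¬ (2 : ℤ) ∣ u := fun hh => no_common 2 not_unit_two huv hh hv2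
      have hu6 : u ^ 6 % 8 = 1 := by
        have : u % 8 = 1 ∨ u % 8 = 3 ∨ u % 8 = 5 ∨ u % 8 = 7 := by omega
        rcases this with h | h | h | h <;> simp [pow_succ, Int.mul_emod, h]
      obtain ⟨x, rfl⟩ := hv2
      by_cases hx2 : (2 : ℤ) ∣ x
      · have hx6 : x ^ 6 % 8 = 0 := by
          obtain ⟨z, rfl⟩ := hx2
          ring_nf; omega
        obtain ⟨w, hw⟩ := part_square (5 * u ^ 6 + x ^ 6) G y 6
          (by linarith [hpos, mul_pow 2 x 6]) (by omega)
          (fun p hp h1 h2 => hcp p hp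
            (by have := h1.mul_left 64; ring_nf at this ⊢; exact this) h2)
          (by rw [h]; ring)
        have : w ^ 2 % 8 = 5 := by rw [← hw]; omega
        have h8 : w % 8 = 0 ∨ w % 8 = 1 ∨ w % 8 = 2 ∨ w % 8 = 3 ∨ w % 8 = 4 ∨ w % 8 = 5 ∨
          w % 8 = 6 ∨ w % 8 = 7 := by omega
        rcases h8 with h | h | h | h | h | h | h | h <;>
          simp [pow_succ, Int.mul_emod, h] at this
      · have hx6 : x ^ 6 % 8 = 1 := by
          have : x % 8 = 1 ∨ x % 8 = 3 ∨ x % 8 = 5 ∨ x % 8 = 7 := by omega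
          rcases this with h | h | h | h <;> simp [pow_succ, Int.mul_emod, h]
        obtain ⟨T, hT⟩ : (2 : ℤ) ∣ 5 * u ^ 6 + x ^ 6 := by omega
        have hF : 320 * u ^ 6 + (2 * x) ^ 6 = 128 * T := by linear_combination 64 * hT
        obtain ⟨w, hw⟩ := part_square T G y 7
          (by linarith) (by omega)
          (fun p hp h1 h2 => hcp p hp (by rw [hF]; exact h1.mul_left 128) h2)
          (by rw [h, hF]; ring)
        have : w ^ 2 % 4 = 3 := by rw [← hw]; omega
        have h8 : w % 4 = 0 ∨ w % 4 = 1 ∨ w % 4 = 2 ∨ w % 4 = 3 := by omega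
        rcases h8 with h | h | h | h <;>
          simp [pow_succ, Int.mul_emod, h] at this
    · obtain ⟨w, hw⟩ := part_square (320 * u ^ 6 + v ^ 6) G y 0 hpos
        (by
          intro hh
          have : (2 : ℤ) ∣ v ^ 6 := by omega
          exact hv2 (p2.dvd_of_dvd_pow this))
        hcp (by rw [h]; ring)
      exact F1_not_square u v w huv hv2 hv5 hw
  refine ⟨hu, ?_⟩
  subst hu
  have hv : v = 1 ∨ v = -1 := Int.isUnit_iff.mp (isCoprime_zero_left.mp huv)
  rcases hv with rfl | rfl
  · left
    refine ⟨rfl, rfl, ?_⟩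
    norm_num at h; simpa using h
  · right
    refine ⟨rfl, rfl, ?_⟩
    norm_num at h; simpa using h
end
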